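/- arXiv:1809.05775 — 3 statements merged into one kernel-verified Lean document; each statement's English description precedes it below -/
import Mathlib

section
/- Grünbaum's classic inequality: for every convex body K ⊂ ℝⁿ with centroid at the origin and every unit vector ξ ∈ S^{n-1}, vol_n(K ∩ {x : ⟨x,ξ⟩ ≥ 0}) ≥ (n/(n+1))ⁿ vol_n(K). -/
open MeasureTheory
open scoped RealInnerProductSpace

namespace Grun
open Set ENNReal Filter Topology
open scoped Pointwise

lemma bm_compact {A B C : Set ℝ} (hA : IsCompact A) (hB : IsCompact B) (hA0 : A.Nonempty)
    (hB0 : B.Nonempty) (h : ∀ a ∈ A, ∀ b ∈ B, a + b ∈ C) :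
    volume A + volume B ≤ volume C := by
  obtain ⟨a1, ha1, hamax⟩ := hA.exists_isMaxOn hA0 continuousOn_id
  obtain ⟨b0, hb0, hbmin⟩ := hB.exists_isMinOn hB0 continuousOn_id
  have h1 : volume ((fun x => x + b0) '' A) = volume A := by simp
  have h2 : volume ((fun x => a1 + x) '' B) = volume B := by simp
  have hm2 : MeasurableSet ((fun x => a1 + x) '' B) :=
    (hB.image (by fun_prop)).measurableSet
  rw [← h1, ← h2, ← measure_union₀ hm2.nullMeasurableSet]
  · apply measure_mono
    rintro x (⟨a, ha, rfl⟩ | ⟨b, hb, rfl⟩)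
    · exact h a ha b0 hb0
    · exact h a1 ha1 b hb
  · have : ((fun x => x + b0) '' A) ∩ ((fun x => a1 + x) '' B) ⊆ {a1 + b0} := by
      rintro x ⟨⟨a, ha, rfl⟩, ⟨b, hb, hab⟩⟩
      have e1 : a ≤ a1 := hamax ha
      have e2 : b0 ≤ b := hbmin hb
      simp only at hab ⊢
      simp only [mem_singleton_iff]
      linarith
    exact measure_mono_null this (by simp)

lemma bm_one {A B C : Set ℝ} (hA : MeasurableSet A) (hB : MeasurableSet B) (hA0 : A.Nonempty)
    (hB0 : B.Nonempty) (h : ∀ a ∈ A, ∀ b ∈ B, a + b ∈ C) :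
    volume A + volume B ≤ volume C := by
  obtain ⟨a0, ha0⟩ := hA0
  obtain ⟨b0, hb0⟩ := hB0
  rw [hA.measure_eq_iSup_isCompact, hB.measure_eq_iSup_isCompact]
  have key := ENNReal.biSup_add_biSup_le' (p := fun K : Set ℝ => K ⊆ A ∧ IsCompact K)
    (q := fun K : Set ℝ => K ⊆ B ∧ IsCompact K) (f := fun K => volume K)
    (g := fun K => volume K) (a := volume C) ⟨∅, by simp⟩ ⟨∅, by simp⟩ ?_
  · simpa only [iSup_and] using key
  · rintro K ⟨hKA, hK⟩ L ⟨hLB, hL⟩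
    have := bm_compact (A := insert a0 K) (B := insert b0 L) (C := C) (hK.insert _) (hL.insert _)
      (by simp) (by simp) (by
        intro a ha b hb
        refine h a ?_ b ?_
        · rcases ha with rfl | ha
          exacts [ha0, hKA ha]
        · rcases hb with rfl | hb
          exacts [hb0, hLB hb])
    refine le_trans (add_le_add (measure_mono (subset_insert _ _))
      (measure_mono (subset_insert _ _))) this

lemma layer {f : ℝ → ℝ≥0∞} (hf : Measurable f) (h1 : ∀ x, f x ≤ 1) :
    ∫⁻ x, f x = ∫⁻ t in Ioo (0:ℝ) 1, volume {x | ENNReal.ofReal t < f x} := by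
  have hne : ∀ x, f x ≠ ∞ := fun x => ne_top_of_le_ne_top one_ne_top (h1 x)
  have e : ∫⁻ x, f x = ∫⁻ x, ENNReal.ofReal ((f x).toReal) := by
    congr 1; ext x; rw [ENNReal.ofReal_toReal (hne x)]
  rw [e, lintegral_eq_lintegral_meas_lt volume (Eventually.of_forall fun x => by simp)
    (hf.ennreal_toReal.aemeasurable)]
  have e2 : ∀ t ∈ Ioi (0:ℝ), volume {x | t < (f x).toReal} =
      (Ioo (0:ℝ) 1).indicator (fun t => volume {x | ENNReal.ofReal t < f x}) t := by
    intro t ht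
    have : {x | t < (f x).toReal} = {x | ENNReal.ofReal t < f x} := by
      ext x
      simp only [mem_ofPred_eq]
      rw [ENNReal.ofReal_lt_iff_lt_toReal (le_of_lt ht) (hne x)]
    rw [this]
    by_cases h : t < 1
    · rw [indicator_of_mem (show t ∈ Ioo (0:ℝ) 1 from ⟨ht, h⟩)]
    · rw [indicator_of_notMem (fun hh => h hh.2)]
      convert measure_empty (μ := (volume : Measure ℝ))
      ext x
      simp only [mem_ofPred_eq, mem_empty_iff_false, iff_false, not_lt]
      refine (h1 x).trans ?_
      rw [← ENNReal.ofReal_one]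
      exact ENNReal.ofReal_le_ofReal (not_lt.1 h)
  rw [setLIntegral_congr_fun measurableSet_Ioi e2, lintegral_indicator measurableSet_Ioo,
    Measure.restrict_restrict measurableSet_Ioo]
  congr 2
  ext x; simp only [mem_inter_iff, mem_Ioo, mem_Ioi]; tauto

lemma vol_smul_image (p : ℝ) (hp : 0 < p) (A : Set ℝ) :
    volume ((fun x => p * x) '' A) = ENNReal.ofReal p * volume A := by
  have : ((fun x => p * x) '' A) = p • A := rfl
  rw [this, Measure.addHaar_smul]
  simp [abs_of_pos hp]

lemma pl_norm {f g h : ℝ → ℝ≥0∞} (hf : Measurable f) (hg : Measurable g) (hh : Measurable h)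
    {p q : ℝ} (hp : 0 < p) (hq : 0 < q) (hpq : p + q = 1)
    (hf1 : (⨆ x, f x) = 1) (hg1 : (⨆ x, g x) = 1)
    (H : ∀ x y, f x ^ p * g y ^ q ≤ h (p * x + q * y)) :
    ENNReal.ofReal p * (∫⁻ x, f x) + ENNReal.ofReal q * (∫⁻ x, g x) ≤ ∫⁻ x, h x := by
  have hfle : ∀ x, f x ≤ 1 := fun x => hf1 ▸ le_iSup f x
  have hgle : ∀ x, g x ≤ 1 := fun x => hg1 ▸ le_iSup g x
  calc _ ≤ ∫⁻ x, min (h x) 1 := ?_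
    _ ≤ _ := lintegral_mono fun x => min_le_left _ _
  rw [layer hf hfle, layer hg hgle, layer (hh.min measurable_const) (fun x => min_le_right _ _)]
  rw [← lintegral_const_mul' _ _ ofReal_ne_top, ← lintegral_const_mul' _ _ ofReal_ne_top]
  refine (le_lintegral_add _ _).trans ?_
  refine setLIntegral_mono' measurableSet_Ioo ?_
  intro t ht
  have ht1 : ENNReal.ofReal t < 1 := by
    rw [← ENNReal.ofReal_one]; exact (ENNReal.ofReal_lt_ofReal_iff one_pos).2 ht.2
  rw [← vol_smul_image p hp, ← vol_smul_image q hq]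
  apply bm_one
  · exact (measurableEmbedding_mulLeft₀ hp.ne').measurableSet_image.2 (measurableSet_lt measurable_const hf)
  · exact (measurableEmbedding_mulLeft₀ hq.ne').measurableSet_image.2 (measurableSet_lt measurable_const hg)
  · exact Set.Nonempty.image _ (s := {x | ENNReal.ofReal t < f x})
      (by obtain ⟨x, hx⟩ := lt_iSup_iff.1 (hf1 ▸ ht1); exact ⟨x, hx⟩)
  · exact Set.Nonempty.image _ (s := {x | ENNReal.ofReal t < g x})
      (by obtain ⟨x, hx⟩ := lt_iSup_iff.1 (hg1 ▸ ht1); exact ⟨x, hx⟩)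
  · rintro _ ⟨x, hx, rfl⟩ _ ⟨y, hy, rfl⟩
    refine lt_min (lt_of_lt_of_le ?_ (H x y)) ht1
    simp only [mem_ofPred_eq] at hx hy
    have e : ENNReal.ofReal t = ENNReal.ofReal t ^ p * ENNReal.ofReal t ^ q := by
      rw [← ENNReal.rpow_add_of_nonneg _ _ hp.le hq.le, hpq, ENNReal.rpow_one]
    rw [e]
    exact ENNReal.mul_lt_mul (ENNReal.rpow_lt_rpow hx hp) (ENNReal.rpow_lt_rpow hy hq)

lemma amgm (a b : ℝ≥0∞) {p q : ℝ} (hp : 0 < p) (hq : 0 < q) (hpq : p + q = 1) :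
    a ^ p * b ^ q ≤ ENNReal.ofReal p * a + ENNReal.ofReal q * b := by
  have hc : p⁻¹.HolderConjugate q⁻¹ := by
    rw [Real.holderConjugate_iff]
    constructor
    · rw [one_lt_inv₀ hp]; linarith
    · simpa using hpq
  have := ENNReal.young_inequality (a ^ p) (b ^ q) hc
  rw [← ENNReal.rpow_mul, ← ENNReal.rpow_mul, mul_inv_cancel₀ hp.ne', mul_inv_cancel₀ hq.ne',
    ENNReal.rpow_one, ENNReal.rpow_one, ENNReal.ofReal_inv_of_pos hp, ENNReal.ofReal_inv_of_pos hq,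
    div_eq_mul_inv, div_eq_mul_inv, inv_inv, inv_inv] at this
  rwa [mul_comm a, mul_comm b] at this

lemma pl_bdd {f g h : ℝ → ℝ≥0∞} (hf : Measurable f) (hg : Measurable g) (hh : Measurable h)
    {p q : ℝ} (hp : 0 < p) (hq : 0 < q) (hpq : p + q = 1)
    (hf1 : (⨆ x, f x) ≠ ∞) (hg1 : (⨆ x, g x) ≠ ∞)
    (H : ∀ x y, f x ^ p * g y ^ q ≤ h (p * x + q * y)) :
    (∫⁻ x, f x) ^ p * (∫⁻ x, g x) ^ q ≤ ∫⁻ x, h x := by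
  set S := ⨆ x, f x with hS
  set T := ⨆ x, g x with hT
  by_cases hS0 : S = 0
  · have : ∀ x, f x = 0 := ENNReal.iSup_eq_zero.1 (hS ▸ hS0)
    simp [this, hp]
  by_cases hT0 : T = 0
  · have : ∀ x, g x = 0 := ENNReal.iSup_eq_zero.1 (hT ▸ hT0)
    simp [this, hq]
  have key := pl_norm (f := fun x => S⁻¹ * f x) (g := fun x => T⁻¹ * g x)
    (h := fun x => (S⁻¹ ^ p * T⁻¹ ^ q) * h x) (hf.const_mul _) (hg.const_mul _) (hh.const_mul _)
    hp hq hpq (by rw [← ENNReal.mul_iSup, ENNReal.inv_mul_cancel hS0 hf1])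
    (by rw [← ENNReal.mul_iSup, ENNReal.inv_mul_cancel hT0 hg1])
    (by
      intro x y
      rw [ENNReal.mul_rpow_of_nonneg _ _ hp.le, ENNReal.mul_rpow_of_nonneg _ _ hq.le]
      calc _ = (S⁻¹ ^ p * T⁻¹ ^ q) * (f x ^ p * g y ^ q) := by ring
        _ ≤ _ := by gcongr; exact H x y)
  have := (amgm _ _ hp hq hpq).trans key
  rw [lintegral_const_mul _ hf, lintegral_const_mul _ hg, lintegral_const_mul _ hh,
    ENNReal.mul_rpow_of_nonneg _ _ hp.le, ENNReal.mul_rpow_of_nonneg _ _ hq.le] at this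
  have e : S⁻¹ ^ p * (∫⁻ x, f x) ^ p * (T⁻¹ ^ q * (∫⁻ x, g x) ^ q) =
    (S⁻¹ ^ p * T⁻¹ ^ q) * ((∫⁻ x, f x) ^ p * (∫⁻ x, g x) ^ q) := by ring
  rw [e] at this
  refine (ENNReal.mul_le_mul_iff_right ?_ ?_).1 this
  · simp [hS0, hT0, hf1, hg1, hp, hq, hp.le, hq.le]
  · apply ENNReal.mul_ne_top
    · simp [hS0, hT0, hf1, hg1, hp, hq, hp.le, hq.le]
    · simp [hS0, hT0, hf1, hg1, hp, hq, hp.le, hq.le]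

lemma tendsto_trunc {f : ℝ → ℝ≥0∞} (hf : Measurable f) :
    Tendsto (fun N : ℕ => ∫⁻ x, min (f x) N) atTop (𝓝 (∫⁻ x, f x)) := by
  refine lintegral_tendsto_of_tendsto_of_monotone
    (fun N => (hf.min measurable_const).aemeasurable) ?_ ?_
  · refine Eventually.of_forall fun x N M hNM => ?_
    exact min_le_min le_rfl (by exact_mod_cast hNM)
  · refine Eventually.of_forall fun x => ?_
    have : Tendsto (fun N : ℕ => min (f x) (N : ℝ≥0∞)) atTop (𝓝 (min (f x) ∞)) :=
      tendsto_const_nhds.min ENNReal.tendsto_nat_nhds_top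
    simpa using this

lemma pl_one {f g h : ℝ → ℝ≥0∞} (hf : Measurable f) (hg : Measurable g) (hh : Measurable h)
    {p q : ℝ} (hp : 0 < p) (hq : 0 < q) (hpq : p + q = 1)
    (H : ∀ x y, f x ^ p * g y ^ q ≤ h (p * x + q * y)) :
    (∫⁻ x, f x) ^ p * (∫⁻ x, g x) ^ q ≤ ∫⁻ x, h x := by
  by_cases hf0 : ∫⁻ x, f x = 0
  · simp [hf0, hp]
  by_cases hg0 : ∫⁻ x, g x = 0
  · simp [hg0, hq]
  have t1 := ((ENNReal.continuous_rpow_const (y := p)).tendsto _).comp (tendsto_trunc hf)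
  have t2 := ((ENNReal.continuous_rpow_const (y := q)).tendsto _).comp (tendsto_trunc hg)
  refine le_of_tendsto (ENNReal.Tendsto.mul t1 (Or.inl ?_) t2 (Or.inl ?_)) ?_
  · simp [hf0, hp, hp.le]
  · simp [hg0, hq, hq.le]
  refine Eventually.of_forall fun N => ?_
  have bd : ∀ u : ℝ → ℝ≥0∞, (⨆ x, min (u x) (N : ℝ≥0∞)) ≠ ∞ := fun u =>
    ne_top_of_le_ne_top (ENNReal.natCast_ne_top N) (iSup_le fun x => min_le_right _ _)
  refine pl_bdd (hf.min measurable_const) (hg.min measurable_const) hh hp hq hpq (bd f) (bd g) ?_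
  intro x y
  refine le_trans ?_ (H x y)
  gcongr <;> exact min_le_left _ _

/-- Prékopa–Leindler. -/
theorem pl (n : ℕ) {p q : ℝ} (hp : 0 < p) (hq : 0 < q) (hpq : p + q = 1) :
    ∀ {f g h : (Fin n → ℝ) → ℝ≥0∞}, Measurable f → Measurable g → Measurable h →
    (∀ x y, f x ^ p * g y ^ q ≤ h (p • x + q • y)) →
    (∫⁻ x, f x) ^ p * (∫⁻ x, g x) ^ q ≤ ∫⁻ x, h x := by
  induction n with
  | zero =>
    intro f g h hf hg hh H
    rw [Measure.volume_pi_eq_dirac 0, lintegral_dirac, lintegral_dirac, lintegral_dirac]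
    simpa using H 0 0
  | succ n ih =>
    intro f g h hf hg hh H
    let e := (MeasurableEquiv.piFinSuccAbove (fun _ : Fin (n+1) => ℝ) 0).symm
    have he : MeasurePreserving e :=
      (volume_preserving_piFinSuccAbove (fun _ : Fin (n + 1) => ℝ) 0).symm _
    have fub : ∀ u : (Fin (n+1) → ℝ) → ℝ≥0∞, Measurable u →
        ∫⁻ x, u x = ∫⁻ t, ∫⁻ y, u (e (t, y)) := by
      intro u hu
      rw [← he.lintegral_comp hu]
      exact lintegral_prod _ (hu.comp e.measurable).aemeasurable
    have hm : ∀ u : (Fin (n+1) → ℝ) → ℝ≥0∞, Measurable u →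
        Measurable fun t => ∫⁻ y, u (e (t, y)) := fun u hu =>
      Measurable.lintegral_prod_right' (f := fun z => u (e z)) (hu.comp e.measurable)
    rw [fub f hf, fub g hg, fub h hh]
    refine pl_one (hm f hf) (hm g hg) (hm h hh) hp hq hpq ?_
    intro s t
    have hs : ∀ s : ℝ, Measurable fun y => e (s, y) := fun s =>
      e.measurable.comp measurable_prodMk_left
    refine ih (hf.comp (hs s)) (hg.comp (hs t)) (hh.comp (hs _)) ?_
    intro x y
    refine (H _ _).trans (le_of_eq ?_)
    congr 1
    have : ∀ (s : ℝ) (y : Fin n → ℝ), e (s, y) = Fin.cons s y := by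
      intro s y
      simp [e, MeasurableEquiv.piFinSuccAbove, Fin.insertNthEquiv]
    rw [this, this, this]
    ext i
    refine Fin.cases ?_ (fun j => ?_) i <;> simp


lemma bm_mul {n : ℕ} {A B C : Set (EuclideanSpace ℝ (Fin n))} (hA : MeasurableSet A)
    (hB : MeasurableSet B) (hC : MeasurableSet C)
    {p q : ℝ} (hp : 0 < p) (hq : 0 < q) (hpq : p + q = 1)
    (h : ∀ a ∈ A, ∀ b ∈ B, p • a + q • b ∈ C) :
    volume A ^ p * volume B ^ q ≤ volume C := by
  have e : ∀ D : Set (EuclideanSpace ℝ (Fin n)), MeasurableSet D →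
      volume D = ∫⁻ x : Fin n → ℝ, D.indicator (fun _ => (1 : ℝ≥0∞)) (WithLp.toLp 2 x) := by
    intro D hD
    rw [(PiLp.volume_preserving_toLp (Fin n)).lintegral_comp (measurable_const.indicator hD),
      lintegral_indicator hD]
    simp
  have hm := (PiLp.volume_preserving_toLp (Fin n)).measurable
  rw [e A hA, e B hB, e C hC]
  refine pl n hp hq hpq ((measurable_const.indicator hA).comp hm)
    ((measurable_const.indicator hB).comp hm) ((measurable_const.indicator hC).comp hm) ?_
  intro x y
  by_cases hx : WithLp.toLp 2 x ∈ A
  · by_cases hy : WithLp.toLp 2 y ∈ B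
    · have := h _ hx _ hy
      rw [← WithLp.toLp_smul, ← WithLp.toLp_smul, ← WithLp.toLp_add] at this
      rw [indicator_of_mem hx, indicator_of_mem hy, indicator_of_mem this]
      simp
    · simp [hy, hq]
  · simp [hx, hp]

lemma bm_n {n : ℕ} {A B C : Set (EuclideanSpace ℝ (Fin n))} (hA : MeasurableSet A)
    (hB : MeasurableSet B) (hC : MeasurableSet C) {α β : ℝ} (hα : 0 < α) (hβ : 0 < β)
    (hvA : volume A = ENNReal.ofReal (α ^ n)) (hvB : volume B = ENNReal.ofReal (β ^ n))
    {p q : ℝ} (hp : 0 < p) (hq : 0 < q)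
    (h : ∀ a ∈ A, ∀ b ∈ B, p • a + q • b ∈ C) :
    ENNReal.ofReal ((p * α + q * β) ^ n) ≤ volume C := by
  set s := p * α + q * β with hs
  have hs0 : 0 < s := by positivity
  have vol1 : ∀ (D : Set (EuclideanSpace ℝ (Fin n))) (γ : ℝ), 0 < γ →
      volume ((γ • ·) ⁻¹' D) = ENNReal.ofReal ((γ ^ n)⁻¹) * volume D := by
    intro D γ hγ
    rw [Measure.addHaar_preimage_smul _ hγ.ne']
    rw [finrank_euclideanSpace_fin, abs_of_pos (by positivity)]
  have msm : ∀ (D : Set (EuclideanSpace ℝ (Fin n))) (γ : ℝ), MeasurableSet D →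
      MeasurableSet ((γ • ·) ⁻¹' D) := fun D γ hD => (measurable_const_smul γ) hD
  have key := bm_mul (msm A α hA) (msm B β hB) (msm C s hC) (p := p * α / s) (q := q * β / s)
    (by positivity) (by positivity) (by rw [← add_div, ← hs, div_self hs0.ne']) (by
      intro a ha b hb
      have := h _ ha _ hb
      simp only [mem_preimage]
      convert this using 1
      rw [smul_add, smul_smul, smul_smul, smul_smul, smul_smul, mul_div_cancel₀ _ hs0.ne',
        mul_div_cancel₀ _ hs0.ne'])
  have one : ∀ γ : ℝ, 0 < γ → ENNReal.ofReal ((γ ^ n)⁻¹) * ENNReal.ofReal (γ ^ n) = 1 := by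
    intro γ hγ
    rw [← ENNReal.ofReal_mul (by positivity), inv_mul_cancel₀ (by positivity), ENNReal.ofReal_one]
  rw [vol1 _ _ hα, vol1 _ _ hβ, vol1 _ _ hs0, hvA, hvB, one _ hα, one _ hβ, ENNReal.one_rpow,
    ENNReal.one_rpow, one_mul] at key
  calc ENNReal.ofReal (s ^ n) = ENNReal.ofReal (s ^ n) * 1 := by rw [mul_one]
    _ ≤ ENNReal.ofReal (s ^ n) * (ENNReal.ofReal ((s ^ n)⁻¹) * volume C) := by gcongr
    _ = _ := by rw [← mul_assoc, mul_comm (ENNReal.ofReal (s ^ n)), one _ hs0, one_mul]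

lemma support {S : Set ℝ} {G : ℝ → ℝ} (hG : ConcaveOn ℝ S G) (h0 : 0 ∈ S)
    (hpos : ∃ t ∈ S, 0 < t) (hneg : ∃ s ∈ S, s < 0) : ∃ c, ∀ t ∈ S, G t ≤ G 0 - c * t := by
  obtain ⟨b, hbS, hb⟩ := hpos
  obtain ⟨s0, hs0, hs0'⟩ := hneg
  have key : ∀ s ∈ S, s < 0 → ∀ t ∈ S, 0 < t → (G s - G 0) / (-s) ≤ (G 0 - G t) / t := by
    intro s hs hs' t ht ht'
    have := hG.2 hs ht
      (show 0 ≤ t / (t - s) from div_nonneg ht'.le (by linarith))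
        (show 0 ≤ -s / (t - s) from div_nonneg (by linarith) (by linarith))
      (by rw [← add_div, ← sub_eq_add_neg, div_self (by linarith)])
    have hts : 0 < t - s := by linarith
    simp only [smul_eq_mul] at this
    have e : t / (t - s) * s + -s / (t - s) * t = 0 := by field_simp; ring
    rw [e] at this
    have e2 : t / (t - s) * G s + -s / (t - s) * G t = (t * G s + -s * G t) / (t - s) := by
      field_simp
    rw [e2, div_le_iff₀ hts] at this
    rw [div_le_div_iff₀ (by linarith) ht']
    nlinarith
  obtain ⟨c, hc1, hc2⟩ := exists_between_of_forall_le
    (s := (fun s => (G s - G 0) / (-s)) '' {s | s ∈ S ∧ s < 0})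
    (t := (fun t => (G 0 - G t) / t) '' {s | s ∈ S ∧ 0 < s})
    ⟨_, s0, ⟨hs0, hs0'⟩, rfl⟩ ⟨_, b, ⟨hbS, hb⟩, rfl⟩ (by
      rintro _ ⟨s, ⟨hs, hs'⟩, rfl⟩ _ ⟨t, ⟨ht, ht'⟩, rfl⟩
      exact key s hs hs' t ht ht')
  refine ⟨c, fun t ht => ?_⟩
  rcases lt_trichotomy t 0 with h | h | h
  · have := hc1 ⟨t, ⟨ht, h⟩, rfl⟩
    simp only at this
    rw [div_le_iff₀ (by linarith)] at this
    linarith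
  · simp [h]
  · have := hc2 ⟨t, ⟨ht, h⟩, rfl⟩
    simp only at this
    rw [le_div_iff₀ h] at this
    linarith

lemma oneD {n : ℕ} (hn : 1 ≤ n) {V : ℝ → ℝ} (hV : Antitone V) (hV0 : ∀ t, 0 ≤ V t)
    {R v : ℝ} (hR : 0 < R) (hv : 0 < v) (hVR : V (-R) = v)
    (hc : ∀ s t p q α β : ℝ, 0 < α → 0 < β → V s = α ^ n → V t = β ^ n → 0 < p → 0 < q →
      p + q = 1 → (p * α + q * β) ^ n ≤ V (p * s + q * t))
    (hpos : ∃ t, 0 < t ∧ 0 < V t) (hint : ∫ t in Ioi (-R), V t = R * v) :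
    ((n : ℝ) / (n + 1)) ^ n * v ≤ V 0 := by
  have hn0 : n ≠ 0 := by omega
  set G : ℝ → ℝ := fun t => (V t / v) ^ ((n : ℝ)⁻¹) with hGdef
  have hGn : ∀ t, V t = v * G t ^ n := by
    intro t
    simp only [hGdef]
    rw [Real.rpow_inv_natCast_pow (div_nonneg (hV0 t) hv.le) hn0]
    field_simp
  have hG0 : ∀ t, 0 ≤ G t := fun t => Real.rpow_nonneg (div_nonneg (hV0 t) hv.le) _
  have hGanti : Antitone G := fun s t hst =>
    Real.rpow_le_rpow (div_nonneg (hV0 t) hv.le) (div_le_div_of_nonneg_right (hV hst) hv.le)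
      (by positivity)
  have hGR : G (-R) = 1 := by simp [hGdef, hVR, hv.ne']
  obtain ⟨b, hb, hVb⟩ := hpos
  set S : Set ℝ := {t | 0 < V t} with hS
  have hSG : ∀ t ∈ S, 0 < G t := fun t ht => Real.rpow_pos_of_pos (div_pos ht hv) _
  have hSmem : ∀ t s, s ≤ t → t ∈ S → s ∈ S := fun t s h ht => lt_of_lt_of_le ht (hV h)
  set w : ℝ := v ^ ((n : ℝ)⁻¹) with hw
  have hw0 : 0 < w := Real.rpow_pos_of_pos hv _
  have hwn : w ^ n = v := Real.rpow_inv_natCast_pow hv.le hn0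
  have hconc : ConcaveOn ℝ S G := by
    rw [concaveOn_iff_forall_pos]
    constructor
    · apply OrdConnected.convex
      refine ⟨fun x hx y hy z hz => hSmem y z hz.2 hy⟩
    · intro x hx y hy p q hp hq hpq
      have := hc x y p q (w * G x) (w * G y) (mul_pos hw0 (hSG x hx)) (mul_pos hw0 (hSG y hy))
        (by rw [mul_pow, hwn, ← hGn]) (by rw [mul_pow, hwn, ← hGn]) hp hq hpq
      have e : p * (w * G x) + q * (w * G y) = w * (p * G x + q * G y) := by ring
      rw [hGn (p * x + q * y), e, mul_pow, hwn] at this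
      have := le_of_mul_le_mul_left this hv
      simp only [smul_eq_mul]
      exact le_of_pow_le_pow_left₀ hn0 (hG0 _) this
  have h0S : (0:ℝ) ∈ S := hSmem b 0 hb.le hVb
  have hRS : (-R) ∈ S := hSmem b (-R) (by linarith) hVb
  obtain ⟨c, hcS⟩ := support hconc h0S ⟨b, hVb, hb⟩ ⟨-R, hRS, by linarith⟩
  have hcR : 1 ≤ G 0 + c * R := by have := hcS _ hRS; rw [hGR] at this; linarith
  suffices hmain : (n : ℝ) / (n + 1) ≤ G 0 by
    rw [hGn 0, mul_comm v]
    gcongr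
  have hG01 : G 0 ≤ 1 := by rw [← hGR]; exact hGanti (by linarith)
  rcases le_or_gt c 0 with hc0 | hc0
  · have : 1 ≤ G 0 := by nlinarith
    refine le_trans ?_ this
    rw [div_le_one (by positivity)]; linarith
  set g := G 0 with hg
  have hg0 : 0 < g := hSG 0 h0S
  set z := g / c with hz
  set t1 := -(1 - g) / c with ht1
  have ht1R : -R ≤ t1 := by rw [ht1, le_div_iff₀ hc0]; linarith
  have ht1z : t1 ≤ z := by rw [ht1, hz]; gcongr; linarith
  have hzero : ∀ t, z < t → V t = 0 := by
    intro t ht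
    by_contra hne
    have htS : t ∈ S := lt_of_le_of_ne (hV0 t) (Ne.symm hne)
    have h1 := hcS t htS
    have h2 := hSG t htS
    rw [hz, div_lt_iff₀ hc0] at ht
    linarith
  have hI : ∀ x y, IntervalIntegrable V volume x y := fun x y => hV.intervalIntegrable
  have e1 : ∫ t in Ioi (-R), V t = ∫ t in (-R)..z, V t := by
    rw [intervalIntegral.integral_of_le (ht1R.trans ht1z)]
    refine setIntegral_eq_of_subset_of_forall_sdiff_eq_zero measurableSet_Ioi
      Ioc_subset_Ioi_self ?_
    rintro t ⟨ht, ht'⟩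
    apply hzero
    by_contra hh
    exact ht' ⟨ht, not_lt.1 hh⟩
  have e2 : ∫ t in (-R)..t1, V t ≤ ∫ t in (-R)..t1, v := by
    refine intervalIntegral.integral_mono_on ht1R (hI _ _) (by simp) ?_
    intro t ht
    rw [← hVR]; exact hV ht.1
  have e3 : ∫ t in t1..z, V t ≤ ∫ t in t1..z, v * (g - c * t) ^ n := by
    refine intervalIntegral.integral_mono_on ht1z (hI _ _)
      (Continuous.intervalIntegrable (by fun_prop) _ _) ?_
    intro t ht
    by_cases htS : t ∈ S
    · rw [hGn]
      have := hcS t htS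
      have := hG0 t
      gcongr
    · have h1 : V t = 0 := le_antisymm (not_lt.1 htS) (hV0 t)
      rw [h1]
      have : 0 ≤ g - c * t := by
        have := ht.2
        rw [hz, le_div_iff₀ hc0] at this
        linarith
      positivity
  have e4 : ∫ t in t1..z, v * (g - c * t) ^ n = v * (1 / (c * (n + 1))) := by
    rw [intervalIntegral.integral_const_mul]
    congr 1
    have := intervalIntegral.integral_comp_sub_mul (a := t1) (b := z) (fun x : ℝ => x ^ n) hc0.ne' g
    rw [this, integral_pow]
    have h1 : g - c * z = 0 := by rw [hz]; field_simp; ring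
    have h2 : g - c * t1 = 1 := by rw [ht1]; field_simp; ring
    rw [h1, h2]
    simp
    field_simp
  rw [e1, ← intervalIntegral.integral_add_adjacent_intervals (hI (-R) t1) (hI t1 z)] at hint
  rw [e4] at e3
  rw [intervalIntegral.integral_const, smul_eq_mul] at e2
  have f1 : R * v ≤ (t1 + R) * v + v * (1 / (c * (n + 1))) := by linarith
  have f2 : 0 ≤ v * (t1 + 1 / (c * (n + 1))) := by linarith
  have f3 := nonneg_of_mul_nonneg_right f2 hv
  have f4 : t1 + 1 / (c * (n + 1)) = (g - n / (n + 1)) / c := by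
    rw [ht1]; field_simp; ring
  rw [f4] at f3
  have f5 := mul_nonneg f3 hc0.le
  rw [div_mul_cancel₀ _ hc0.ne'] at f5
  linarith

end Grun

theorem gruenbaum_classic (n : ℕ) (hn : 1 ≤ n)
    (K : Set (EuclideanSpace ℝ (Fin n)))
    (hKconv : Convex ℝ K) (hKcomp : IsCompact K) (hKint : (interior K).Nonempty)
    (hcentroid : (∫ x in K, x) = 0)
    (ξ : EuclideanSpace ℝ (Fin n)) (hξ : ‖ξ‖ = 1) :
    ENNReal.ofReal (((n : ℝ) / ((n : ℝ) + 1)) ^ n) * volume K ≤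
      volume (K ∩ {x | 0 ≤ ⟪x, ξ⟫}) := by
  have hKm : MeasurableSet K := hKcomp.measurableSet
  have hKfin : volume K ≠ ⊤ := hKcomp.measure_lt_top.ne
  have hKpos : 0 < volume K := Measure.measure_pos_of_nonempty_interior _ hKint
  have hcont : Continuous fun x : EuclideanSpace ℝ (Fin n) => ⟪x, ξ⟫ := by fun_prop
  have hHm : ∀ t : ℝ, MeasurableSet {x : EuclideanSpace ℝ (Fin n) | t ≤ ⟪x, ξ⟫} := fun t =>
    (isClosed_le continuous_const hcont).measurableSet
  have hfin : ∀ s, volume (K ∩ s) ≠ ⊤ := fun s =>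
    ne_top_of_le_ne_top hKfin (measure_mono Set.inter_subset_left)
  set V : ℝ → ℝ := fun t => volume.real (K ∩ {x | t ≤ ⟪x, ξ⟫}) with hVdef
  obtain ⟨R0, hR0⟩ := hKcomp.exists_bound_of_continuousOn hcont.continuousOn
  set R := max R0 1 with hRdef
  have hR : 0 < R := lt_of_lt_of_le one_pos (le_max_right _ _)
  have hKR : ∀ x ∈ K, -R ≤ ⟪x, ξ⟫ := fun x hx => by
    have := (abs_le.1 (hR0 x hx)).1
    have := le_max_left R0 1
    linarith
  have hintx : IntegrableOn (fun x : EuclideanSpace ℝ (Fin n) => ⟪x, ξ⟫) K :=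
    hcont.continuousOn.integrableOn_compact hKcomp
  have hzero : ∫ x in K, ⟪x, ξ⟫ = 0 := by
    have hid : Integrable (fun x => x) (volume.restrict K) :=
      (continuous_id.continuousOn.integrableOn_compact hKcomp)
    have := integral_inner (𝕜 := ℝ) hid ξ
    rw [hcentroid, inner_zero_right] at this
    rw [← this]
    congr 1; ext x; exact real_inner_comm _ _
  have key := Grun.oneD (n := n) hn (V := V) (R := R) (v := volume.real K) ?_
    (fun t => measureReal_nonneg) hR (ENNReal.toReal_pos hKpos.ne' hKfin) ?_ ?_ ?_ ?_
  · have h0 : volume (K ∩ {x | 0 ≤ ⟪x, ξ⟫}) = ENNReal.ofReal (V 0) := by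
      rw [hVdef]; exact (ENNReal.ofReal_toReal (hfin _)).symm
    rw [h0, ← ENNReal.ofReal_toReal hKfin, ← ENNReal.ofReal_mul (by positivity)]
    exact ENNReal.ofReal_le_ofReal key
  · intro s t hst
    exact measureReal_mono (Set.inter_subset_inter_right _ fun x hx => le_trans hst hx) (hfin _)
  · simp only [hVdef]
    congr 1
    exact Set.inter_eq_left.2 hKR
  · intro s t p q α β hα hβ hs ht hp hq hpq
    have := Grun.bm_n (A := K ∩ {x | s ≤ ⟪x, ξ⟫}) (B := K ∩ {x | t ≤ ⟪x, ξ⟫})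
      (C := K ∩ {x | p * s + q * t ≤ ⟪x, ξ⟫}) (hKm.inter (hHm _)) (hKm.inter (hHm _))
      (hKm.inter (hHm _)) hα hβ (by rw [← hs]; exact (ENNReal.ofReal_toReal (hfin _)).symm)
      (by rw [← ht]; exact (ENNReal.ofReal_toReal (hfin _)).symm) hp hq (by
        rintro a ⟨haK, ha⟩ b ⟨hbK, hb⟩
        refine ⟨hKconv haK hbK hp.le hq.le hpq, ?_⟩
        simp only [Set.mem_ofPred_eq] at ha hb ⊢
        rw [inner_add_left, real_inner_smul_left, real_inner_smul_left]
        gcongr)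
    exact (ENNReal.ofReal_le_iff_le_toReal (hfin _)).1 this
  · by_contra hcon
    push Not at hcon
    have hV0 : ∀ t, 0 < t → volume (K ∩ {x | t ≤ ⟪x, ξ⟫}) = 0 := by
      intro t ht
      have := le_antisymm (hcon t ht) measureReal_nonneg
      exact (measureReal_eq_zero_iff (hfin _)).1 this
    have hae : ∀ᵐ x ∂(volume.restrict K), ⟪x, ξ⟫ ≤ 0 := by
      have h1 : ∀ᵐ x ∂(volume.restrict K), ∀ k : ℕ, ¬ (1 / ((k : ℝ) + 1) ≤ ⟪x, ξ⟫) := by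
        rw [ae_all_iff]
        intro k
        rw [ae_iff, Measure.restrict_apply' hKm, Set.inter_comm]
        simpa using hV0 (1 / ((k : ℝ) + 1)) (by positivity)
      filter_upwards [h1] with x hx
      by_contra hh
      obtain ⟨k, hk⟩ := exists_nat_one_div_lt (not_le.1 hh)
      exact hx k hk.le
    have hneg : ∫ x in K, -⟪x, ξ⟫ = 0 := by rw [integral_neg, hzero, neg_zero]
    rw [integral_eq_zero_iff_of_nonneg_ae (f := fun x => -⟪x, ξ⟫) (by
      filter_upwards [hae] with x hx
      simpa using hx) hintx.neg] at hneg
    obtain ⟨x0, hx0⟩ := hKint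
    have hsub : volume (interior K ∩ {x | ⟪x, ξ⟫ ≠ 0}) = 0 := by
      rw [Filter.EventuallyEq, ae_restrict_iff' hKm, ae_iff] at hneg
      refine measure_mono_null ?_ hneg
      rintro x ⟨hx, hx'⟩
      simp only [Set.mem_ofPred_eq, Pi.zero_apply, neg_eq_zero]
      exact fun h => hx' (h (interior_subset hx))
    have hopen : IsOpen (interior K ∩ {x | ⟪x, ξ⟫ ≠ 0}) :=
      isOpen_interior.inter (isOpen_ne_fun hcont continuous_const)
    have hempty := (hopen.measure_eq_zero_iff volume).1 hsub
    have hall : ∀ x ∈ interior K, ⟪x, ξ⟫ = 0 := by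
      intro x hx
      by_contra hh
      exact (Set.mem_empty_iff_false x).1 (hempty ▸ ⟨hx, hh⟩)
    obtain ⟨ε, hε, hball⟩ := Metric.isOpen_iff.1 isOpen_interior x0 hx0
    have h2 := hall (x0 + (ε / 2) • ξ) (hball (by
      simp [norm_smul, hξ, abs_of_pos hε]
      exact hε
      ))
    rw [inner_add_left, hall x0 hx0, real_inner_smul_left, real_inner_self_eq_norm_sq, hξ] at h2
    norm_num at h2
    linarith
  · have hi : Integrable (fun x : EuclideanSpace ℝ (Fin n) => ⟪x, ξ⟫ + R) (volume.restrict K) :=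
      hintx.add (integrableOn_const hKfin)
    have hnn : 0 ≤ᵐ[volume.restrict K] fun x : EuclideanSpace ℝ (Fin n) => ⟪x, ξ⟫ + R := by
      filter_upwards [ae_restrict_mem hKm] with x hx
      have := hKR x hx
      simp only [Pi.zero_apply]; linarith
    have lc := hi.integral_eq_integral_meas_le hnn
    have l1 : ∫ x in K, (⟪x, ξ⟫ + R) = R * volume.real K := by
      rw [integral_add hintx (integrableOn_const hKfin), hzero]
      simp [mul_comm]
    rw [l1] at lc
    rw [lc]
    have hsh := (measurePreserving_sub_right (volume : Measure ℝ) R).setIntegral_preimage_emb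
      (measurableEmbedding_subRight R) V (Set.Ioi (-R))
    have hpre : (fun x : ℝ => x - R) ⁻¹' Set.Ioi (-R) = Set.Ioi 0 := by
      ext x; simp
    rw [← hsh, hpre]
    refine setIntegral_congr_fun measurableSet_Ioi fun t _ => ?_
    simp only [hVdef, measureReal_def]
    rw [Measure.restrict_apply' hKm, Set.inter_comm]
    congr 3
    ext x
    simp only [Set.mem_ofPred_eq, sub_le_iff_le_add]
end

section
/- For a convex body K ⊂ ℝ² with centroid at the origin and any unit vector ξ ∈ ℝ², the area of K ∩ {x : ⟨x,ξ⟩ ≥ 0} is at least (4/9) times the area of K. -/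
open MeasureTheory
open scoped RealInnerProductSpace
open Set

lemma gr_pos (f : ℝ → ℝ) (hf0 : ∀ t, 0 ≤ f t) (hfi : Integrable f)
    (htfi : Integrable (fun t => t * f t)) (hc : ∫ t, t * f t = 0) (hpos : 0 < ∫ t, f t) :
    0 < ∫ t in Ioi (0:ℝ), f t := by
  have hnn : 0 ≤ ∫ t in Ioi (0:ℝ), f t := integral_nonneg (fun t => hf0 t)
  rcases hnn.lt_or_eq with h | h
  · exact h
  exfalso
  have h1 := (setIntegral_eq_zero_iff_of_nonneg_ae (Filter.Eventually.of_forall hf0)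
    hfi.integrableOn).1 h.symm
  have h2 : ∀ᵐ t : ℝ, t ∈ Ioi (0:ℝ) → f t = 0 :=
    (ae_restrict_iff' measurableSet_Ioi).1 h1
  have h3 : 0 ≤ᵐ[volume] fun t => -(t * f t) := by
    filter_upwards [h2] with t ht
    rcases lt_or_ge 0 t with h | h
    · simp [ht h]
    · have := mul_nonneg (neg_nonneg.2 h) (hf0 t)
      simp only [Pi.zero_apply]; linarith
  have h4 := (integral_eq_zero_iff_of_nonneg_ae h3 htfi.neg).1 (by rw [integral_neg, hc, neg_zero])
  have h5 : f =ᵐ[volume] 0 := by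
    filter_upwards [h4, Measure.ae_ne volume (0:ℝ)] with t ht h0
    simp only [Pi.zero_apply, neg_eq_zero, mul_eq_zero] at ht ⊢
    tauto
  rw [integral_congr_ae h5] at hpos
  simp at hpos

lemma gr_oneD (f : ℝ → ℝ) (hf0 : ∀ t, 0 ≤ f t) (hfi : Integrable f)
    (htfi : Integrable (fun t => t * f t)) (hc : ∫ t, t * f t = 0) (hpos : 0 < ∫ t, f t)
    (R : ℝ) (hR : ∀ t, 0 < f t → t ≤ R)
    (hconc : ∀ x y a b : ℝ, 0 < f x → 0 < f y → 0 ≤ a → 0 ≤ b → a + b = 1 →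
      a * f x + b * f y ≤ f (a * x + b * y)) :
    4 * ∫ t in Iic (0:ℝ), f t ≤ 5 * ∫ t in Ioi (0:ℝ), f t := by
  have hA := gr_pos f hf0 hfi htfi hc hpos
  have hB := gr_pos (fun t => f (-t)) (fun t => hf0 _) hfi.comp_neg
    (by simpa using htfi.comp_neg.neg)
    (by
      have := integral_neg_eq_self (fun t => t * f t) volume
      rw [hc] at this
      simpa [integral_neg] using this)
    (by rw [integral_neg_eq_self f]; exact hpos)
  have ex : ∀ g : ℝ → ℝ, (∀ t, 0 ≤ g t) → 0 < ∫ t in Ioi (0:ℝ), g t → ∃ t, 0 < t ∧ 0 < g t := by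
    intro g hg hi
    by_contra! hcon
    rw [setIntegral_congr_fun measurableSet_Ioi
      (fun t ht => le_antisymm (hcon t ht) (hg t) : EqOn g (fun _ => 0) (Ioi 0))] at hi
    simp at hi
  obtain ⟨u, hu, hfu⟩ := ex f hf0 hA
  obtain ⟨v, hv, hfv⟩ := ex _ (fun t => hf0 (-t)) hB
  have hz : 0 < f 0 := by
    have := hconc u (-v) (v/(u+v)) (u/(u+v)) hfu hfv (by positivity) (by positivity)
      (by field_simp; ring)
    rw [show v/(u+v) * u + u/(u+v) * (-v) = 0 by ring] at this
    have : 0 < v/(u+v) * f u + u/(u+v) * f (-v) := by positivity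
    linarith
  set A := ∫ t in Ioi (0:ℝ), f t with hAdef
  obtain ⟨q, hq⟩ : ∃ q, q = A / f 0 := ⟨_, rfl⟩
  have hq0 : 0 < q := by rw [hq]; positivity
  obtain ⟨c, hcd⟩ : ∃ c, c = f 0 / (2*q) := ⟨_, rfl⟩
  have hc0 : 0 < c := by rw [hcd]; positivity
  have hfc : f 0 = c * (2 * q) := by rw [hcd]; field_simp
  have hAc : A = 2 * c * q^2 := by
    have : A = q * f 0 := by rw [hq]; field_simp
    rw [this, hfc]; ring
  let L : ℝ → ℝ := fun t => c * (2*q - t)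
  let P : ℝ → ℝ := fun t => max (L t) 0
  have hLc : Continuous L := by fun_prop
  have hPc : Continuous P := by fun_prop
  have hPL : ∀ t ∈ Ioc 0 (2*q), P t = L t := fun t ht =>
    max_eq_left (mul_nonneg hc0.le (by linarith [ht.2]))
  have hP0 : ∀ t, 2*q < t → P t = 0 := fun t ht =>
    max_eq_right (by have := mul_pos hc0 (sub_pos.2 ht); simp only [L]; linarith)
  have hPi : ∀ w : ℝ → ℝ, Continuous w → IntegrableOn (fun t => w t * P t) (Ioi 0) := by
    intro w hw
    refine (((hw.mul hPc).integrableOn_Icc (a := 0) (b := 2*q))).of_forall_sdiff_eq_zero measurableSet_Ioi ?_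
    rintro t ⟨h1, h2⟩
    have : 2*q < t := by by_contra! h; exact h2 ⟨le_of_lt h1, h⟩
    simp [hP0 t this]
  have hPint : ∀ w : ℝ → ℝ, ∫ t in Ioi (0:ℝ), w t * P t = ∫ t in (0:ℝ)..(2*q), w t * L t := by
    intro w
    rw [intervalIntegral.integral_of_le (by positivity),
      ← setIntegral_congr_fun measurableSet_Ioc (fun t ht => by simp only [hPL t ht] :
        EqOn (fun t => w t * P t) (fun t => w t * L t) (Ioc 0 (2*q)))]
    apply setIntegral_eq_of_subset_of_forall_sdiff_eq_zero measurableSet_Ioi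
    · exact Ioc_subset_Ioi_self
    · rintro t ⟨h1, h2⟩
      have : 2*q < t := by by_contra! h; exact h2 ⟨h1, h⟩
      simp [hP0 t this]
  have hPA : ∫ t in Ioi (0:ℝ), P t = A := by
    have := hPint (fun _ => 1)
    simp only [one_mul, L] at this
    rw [this, hAc, intervalIntegral.integral_const_mul, intervalIntegral.integral_sub (by simp) (by simp)]
    simp; ring
  have hPM : ∫ t in Ioi (0:ℝ), t * P t = 4/3 * c * q^3 := by
    rw [hPint (fun t => t)]
    have : ∀ t : ℝ, t * L t = c * (2*q) * t - c * t^2 := fun t => by simp only [L]; ring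
    simp only [this]
    rw [intervalIntegral.integral_sub (by apply Continuous.intervalIntegrable; fun_prop)
      (by apply Continuous.intervalIntegrable; fun_prop)]
    rw [intervalIntegral.integral_const_mul, intervalIntegral.integral_const_mul]
    simp; ring
  have hPi1 : IntegrableOn P (Ioi 0) := by simpa using hPi (fun _ => 1) continuous_const
  have hPi2 : IntegrableOn (fun t => t * P t) (Ioi 0) := hPi (fun t => t) continuous_id
  let S : Set ℝ := {s | 0 < s ∧ 0 < f s ∧ P s ≤ f s}
  have hSne : S.Nonempty := by
    by_contra hne
    rw [not_nonempty_iff_eq_empty] at hne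
    have hlt : ∀ t, 0 < t → 0 < f t → f t < P t := by
      intro t ht hft
      by_contra! h
      have : t ∈ S := ⟨ht, hft, h⟩
      rw [hne] at this; exact this
    have hle : ∀ t ∈ Ioi (0:ℝ), 0 ≤ P t - f t := by
      intro t ht
      rcases (hf0 t).lt_or_eq with h | h
      · linarith [hlt t ht h]
      · rw [← h, sub_zero]; exact le_max_right _ _
    have h1 : ∫ t in Ioi (0:ℝ), (P t - f t) = 0 := by
      rw [integral_sub hPi1 hfi.integrableOn, hPA, sub_self]
    have h2 : 0 < ∫ t in Ioi (0:ℝ), (P t - f t) := by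
      rw [setIntegral_pos_iff_support_of_nonneg_ae
        ((ae_restrict_iff' measurableSet_Ioi).2 (Filter.Eventually.of_forall hle))
        (hPi1.sub hfi.integrableOn)]
      have : Ioo 0 (2*q) ⊆ Function.support (fun t => P t - f t) ∩ Ioi 0 := by
        intro t ht
        refine ⟨?_, ht.1⟩
        simp only [Function.mem_support]
        have hPt : 0 < P t := by
          rw [hPL t ⟨ht.1, ht.2.le⟩]; exact mul_pos hc0 (sub_pos.2 ht.2)
        rcases (hf0 t).lt_or_eq with h | h
        · linarith [hlt t ht.1 h]
        · rw [← h]; linarith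
      refine lt_of_lt_of_le ?_ (measure_mono this)
      simp [hq0]
    linarith
  have hSb : BddAbove S := ⟨R, fun s hs => hR s hs.2.1⟩
  have hSdown : ∀ s ∈ S, ∀ t, 0 < t → t < s → P t ≤ f t := by
    rintro s ⟨hs, hfs, hPs⟩ t ht hts
    have h := hconc s 0 (t/s) (1-t/s) hfs hz (by positivity)
      (by rw [sub_nonneg, div_le_one hs]; exact hts.le) (by ring)
    have e : t/s * s = t := by field_simp
    rw [mul_zero, add_zero, e] at h
    have h1 : 0 < t/s := by positivity
    have hL : L s ≤ f s := (le_max_left _ _).trans hPs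
    refine max_le ?_ (hf0 t)
    have : L t = t/s * L s + (1 - t/s) * f 0 := by
      rw [hfc]; simp only [L]; field_simp; ring
    rw [this]
    nlinarith [mul_le_mul_of_nonneg_left hL h1.le]
  set t0 := sSup S
  have hcross : ∀ t ∈ Ioi (0:ℝ), (t - t0) * (f t - P t) ≤ 0 := by
    intro t ht
    rcases lt_trichotomy t t0 with h | h | h
    · obtain ⟨s, hs, hts⟩ := exists_lt_of_lt_csSup hSne h
      have := hSdown s hs t ht hts
      exact mul_nonpos_of_nonpos_of_nonneg (by linarith) (by linarith)
    · simp [h]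
    · have hn : t ∉ S := fun hS => absurd (le_csSup hSb hS) (not_le.2 h)
      have : f t ≤ P t := by
        rcases (hf0 t).lt_or_eq with h' | h'
        · by_contra! h2
          exact hn ⟨ht, h', h2.le⟩
        · rw [← h']; exact le_max_right _ _
      exact mul_nonpos_of_nonneg_of_nonpos (by linarith) (by linarith)
  have hMp : ∫ t in Ioi (0:ℝ), t * f t ≤ 4/3 * c * q^3 := by
    have h1 : ∫ t in Ioi (0:ℝ), (t - t0) * (f t - P t) ≤ 0 :=
      setIntegral_nonpos measurableSet_Ioi hcross
    have h2 : ∫ t in Ioi (0:ℝ), (t - t0) * (f t - P t) =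
        ((∫ t in Ioi (0:ℝ), t * f t) - ∫ t in Ioi (0:ℝ), t * P t)
          - t0 * ((∫ t in Ioi (0:ℝ), f t) - ∫ t in Ioi (0:ℝ), P t) := by
      rw [← integral_sub htfi.integrableOn hPi2, ← integral_sub hfi.integrableOn hPi1,
        ← integral_const_mul]
      have e1 : Integrable (fun t => t * f t - t * P t) (volume.restrict (Ioi 0)) :=
        htfi.integrableOn.sub hPi2
      have e2 : Integrable (fun t => t0 * (f t - P t)) (volume.restrict (Ioi 0)) :=
        (hfi.integrableOn.sub hPi1).const_mul _
      rw [← integral_sub e1 e2]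
      congr 1; ext t; ring
    rw [h2, hPM, hPA] at h1
    linarith
  obtain ⟨s, hs, hfs, hPs⟩ := hSne
  have hneg : ∀ t ≤ 0, f t ≤ L t := by
    intro t ht
    have hLt : 0 < L t := mul_pos hc0 (by linarith)
    rcases (hf0 t).lt_or_eq with h | h
    · have hst : 0 < s - t := by linarith
      have h1 := hconc t s (s/(s-t)) (-t/(s-t)) h hfs (by positivity)
        (div_nonneg (by linarith) hst.le) (by field_simp; ring)
      rw [show s/(s-t) * t + -t/(s-t) * s = 0 by ring] at h1
      have hL : L s ≤ f s := (le_max_left _ _).trans hPs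
      have h2 : s * f t + (-t) * f s ≤ (s - t) * f 0 := by
        have := mul_le_mul_of_nonneg_left h1 hst.le
        have e : (s-t) * (s/(s-t) * f t + -t/(s-t) * f s) = s * f t + (-t) * f s := by
          field_simp
        linarith
      have h3 : (-t) * L s ≤ (-t) * f s := mul_le_mul_of_nonneg_left hL (by linarith)
      have h4 : s * f t ≤ s * L t := by
        have : (s - t) * f 0 - (-t) * L s = s * L t := by
          rw [hfc]; simp only [L]; ring
        linarith
      exact le_of_mul_le_mul_left h4 hs
    · rw [← h]; exact hLt.le
  have hMn : ∫ t in Iic (0:ℝ), (q + t) * f t ≤ 7/6 * c * q^3 := by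
    have h1 : ∫ t in Iic (0:ℝ), (q + t) * f t ≤
        ∫ t in Iic (0:ℝ), (Ioc (-q) 0).indicator (fun t => (q + t) * L t) t := by
      apply setIntegral_mono_on
      · have := ((hfi.const_mul q).add htfi).integrableOn (s := Iic 0)
        refine this.congr_fun (fun t _ => ?_) measurableSet_Iic
        simp only [Pi.add_apply]; ring
      · apply Integrable.integrableOn
        rw [integrable_indicator_iff measurableSet_Ioc]
        exact (Continuous.integrableOn_Icc (by fun_prop)).mono_set Ioc_subset_Icc_self
      · exact measurableSet_Iic
      · intro t ht
        by_cases h : t ∈ Ioc (-q) 0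
        · rw [indicator_of_mem h]
          exact mul_le_mul_of_nonneg_left (hneg t ht) (by linarith [h.1])
        · rw [indicator_of_notMem h]
          have : t ≤ -q := by by_contra! h2; exact h ⟨h2, ht⟩
          exact mul_nonpos_of_nonpos_of_nonneg (by linarith) (hf0 t)
    refine h1.trans (le_of_eq ?_)
    rw [setIntegral_indicator measurableSet_Ioc, inter_eq_right.2 Ioc_subset_Iic_self,
      ← intervalIntegral.integral_of_le (by linarith)]
    have : ∀ t : ℝ, (q + t) * L t = c * (2*q^2) + c * q * t - c * t^2 :=
      fun t => by simp only [L]; ring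
    simp only [this]
    rw [intervalIntegral.integral_sub (by apply Continuous.intervalIntegrable; fun_prop)
      (by apply Continuous.intervalIntegrable; fun_prop),
      intervalIntegral.integral_add (by apply Continuous.intervalIntegrable; fun_prop)
      (by apply Continuous.intervalIntegrable; fun_prop)]
    rw [intervalIntegral.integral_const_mul, intervalIntegral.integral_const_mul,
      intervalIntegral.integral_const_mul]
    simp; ring
  have hsplit : (∫ t in Iic (0:ℝ), t * f t) + ∫ t in Ioi (0:ℝ), t * f t = 0 := by
    rw [← hc]; exact intervalIntegral.integral_Iic_add_Ioi htfi.integrableOn htfi.integrableOn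
  have hMn' : ∫ t in Iic (0:ℝ), (q + t) * f t =
      q * (∫ t in Iic (0:ℝ), f t) + ∫ t in Iic (0:ℝ), t * f t := by
    rw [← integral_const_mul, ← integral_add (hfi.integrableOn.const_mul _) htfi.integrableOn]
    congr 1; ext t; ring
  have hfin : q * (∫ t in Iic (0:ℝ), f t) ≤ q * (5/2 * c * q^2) := by nlinarith
  have := le_of_mul_le_mul_left hfin hq0
  rw [hAc]; linarith

lemma gr_plane (K : Set (ℝ × ℝ)) (hK : Convex ℝ K) (hKc : IsCompact K) (hpos : 0 < volume.real K)
    (hcen : ∫ p in K, p.1 = 0) :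
    4 / 9 * volume.real K ≤ volume.real (K ∩ {p | 0 ≤ p.1}) := by
  have hKm : MeasurableSet K := hKc.isClosed.measurableSet
  let f : ℝ → ℝ := fun t => volume.real (Prod.mk t ⁻¹' K)
  have slice : ∀ w : ℝ → ℝ, IntegrableOn (fun p : ℝ × ℝ => w p.1) K →
      Integrable (fun t => w t * f t) ∧ ∫ p in K, w p.1 = ∫ t, w t * f t := by
    intro w hw
    have h1 : Integrable (K.indicator (fun p : ℝ × ℝ => w p.1)) := (integrable_indicator_iff hKm).2 hw
    have h2 : ∀ t, ∫ s, K.indicator (fun p : ℝ × ℝ => w p.1) (t, s) = w t * f t := by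
      intro t
      have : (fun s => K.indicator (fun p : ℝ × ℝ => w p.1) (t, s)) =
          (Prod.mk t ⁻¹' K).indicator (fun _ => w t) := rfl
      rw [this, integral_indicator_const _ (measurable_prodMk_left hKm), smul_eq_mul, mul_comm]
    rw [Measure.volume_eq_prod] at h1
    refine ⟨?_, ?_⟩
    · have := h1.integral_prod_left
      simpa only [h2] using this
    · rw [← integral_indicator hKm, Measure.volume_eq_prod, integral_prod _ h1]
      simp only [h2]
  have hfin : volume K < ⊤ := hKc.measure_lt_top
  have hone := slice (fun _ => 1) (integrableOn_const hfin.ne)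
  have hid := slice (fun t => t) (continuous_fst.continuousOn.integrableOn_compact hKc)
  have hind := slice ((Ioi (0:ℝ)).indicator fun _ => 1) (by
    have : IntegrableOn (fun _ : ℝ × ℝ => (1:ℝ)) K := integrableOn_const hfin.ne
    exact this.indicator (measurable_fst measurableSet_Ioi))
  simp only [one_mul] at hone
  have hvol : volume.real K = ∫ t, f t := by
    rw [← hone.2]; simp
  have hvol' : volume.real (K ∩ {p | 0 < p.1}) = ∫ t in Ioi (0:ℝ), f t := by
    rw [← integral_indicator measurableSet_Ioi]
    have e1 : ∀ t, (Ioi (0:ℝ)).indicator f t = (Ioi (0:ℝ)).indicator (fun _ => 1) t * f t := by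
      intro t; by_cases h : t ∈ Ioi (0:ℝ) <;> simp [h]
    simp only [e1]
    rw [← hind.2]
    have hm : MeasurableSet {p : ℝ × ℝ | 0 < p.1} := measurable_fst measurableSet_Ioi
    have e2 : (fun p : ℝ × ℝ => (Ioi (0:ℝ)).indicator (fun _ => (1:ℝ)) p.1) =
      {p : ℝ × ℝ | 0 < p.1}.indicator (fun _ => 1) := rfl
    rw [e2, setIntegral_indicator hm]
    simp
  have hmono : volume.real (K ∩ {p | 0 < p.1}) ≤ volume.real (K ∩ {p | 0 ≤ p.1}) :=
    measureReal_mono (fun p hp => ⟨hp.1, (show (0:ℝ) < p.1 from hp.2).le⟩)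
      ((measure_mono inter_subset_left).trans_lt hfin).ne
  have hne : ∀ t, 0 < f t → (Prod.mk t ⁻¹' K).Nonempty := by
    intro t ht
    by_contra h
    rw [not_nonempty_iff_eq_empty] at h
    simp [f, h] at ht
  obtain ⟨R, hR⟩ := (hKc.image continuous_fst).bddAbove
  have hsec : ∀ t, Convex ℝ (Prod.mk t ⁻¹' K) := by
    intro t x hx y hy a b ha hb hab
    have := hK hx hy ha hb hab
    simpa [← add_mul, hab] using this
  have hseccomp : ∀ t, IsCompact (Prod.mk t ⁻¹' K) := by
    intro t
    have : Prod.mk t ⁻¹' K ⊆ Prod.snd '' K := fun s hs => ⟨(t, s), hs, rfl⟩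
    exact (hKc.image continuous_snd).of_isClosed_subset
      (hKc.isClosed.preimage (by fun_prop)) this
  have hIcc : ∀ t, 0 < f t → ∃ u v, u ≤ v ∧ Prod.mk t ⁻¹' K = Icc u v := by
    intro t ht
    have h := eq_Icc_of_connected_compact ((hsec t).isConnected (hne t ht)) (hseccomp t)
    refine ⟨_, _, ?_, h⟩
    have := hne t ht
    rw [h] at this
    exact nonempty_Icc.1 this
  have main := gr_oneD f (fun t => measureReal_nonneg) hone.1 hid.1 (hid.2 ▸ hcen) (hvol ▸ hpos) R
    (by
      intro t ht
      obtain ⟨s, hs⟩ := hne t ht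
      exact hR ⟨_, hs, rfl⟩)
    (by
      intro x y a b hx hy ha hb hab
      obtain ⟨u, v, huv, hS⟩ := hIcc x hx
      obtain ⟨u', v', huv', hS'⟩ := hIcc y hy
      have h1 : f x = v - u := by simp [f, hS, huv]
      have h2 : f y = v' - u' := by simp [f, hS', huv']
      have mem : ∀ s ∈ Icc u v, ∀ s' ∈ Icc u' v',
          a * s + b * s' ∈ Prod.mk (a * x + b * y) ⁻¹' K := by
        intro s hs s' hs'
        rw [← hS] at hs
        rw [← hS'] at hs'
        have := hK hs hs' ha hb hab
        simpa using this
      have hsub : Icc (a * u + b * u') (a * v + b * v') ⊆ Prod.mk (a * x + b * y) ⁻¹' K :=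
        (hsec _).ordConnected.out (mem u (left_mem_Icc.2 huv) u' (left_mem_Icc.2 huv'))
          (mem v (right_mem_Icc.2 huv) v' (right_mem_Icc.2 huv'))
      have h3 := measureReal_mono (μ := volume) hsub (hseccomp _).measure_lt_top.ne
      rw [Real.volume_real_Icc_of_le (by nlinarith)] at h3
      rw [h1, h2]
      change _ ≤ volume.real _
      linarith)
  have hsplit := intervalIntegral.integral_Iic_add_Ioi (b := (0:ℝ)) (f := f) hone.1.integrableOn hone.1.integrableOn
  rw [hvol]
  linarith

open scoped RealInnerProductSpace

theorem gruenbaum_planar (K : Set (EuclideanSpace ℝ (Fin 2)))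
    (hKconv : Convex ℝ K) (hKcomp : IsCompact K) (hKint : (interior K).Nonempty)
    (hcentroid : (∫ x in K, x) = 0)
    (ξ : EuclideanSpace ℝ (Fin 2)) (hξ : ‖ξ‖ = 1) :
    ENNReal.ofReal (4 / 9 : ℝ) * volume K ≤ volume (K ∩ {x | 0 ≤ ⟪x, ξ⟫}) := by
  have ho : Orthonormal ℝ (({0} : Set (Fin 2)).domRestrict (fun _ => ξ)) := by
    constructor
    · intro i; exact hξ
    · intro i j hij; exact absurd (Subsingleton.elim i j) hij
  obtain ⟨b, hb⟩ := ho.exists_orthonormalBasis_extension_of_card_eq (by simp)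
  have hb0 : b 0 = ξ := hb 0 rfl
  let e : EuclideanSpace ℝ (Fin 2) ≃L[ℝ] ℝ × ℝ :=
    (b.repr.toContinuousLinearEquiv.trans (EuclideanSpace.equiv (Fin 2) ℝ)).trans
      (ContinuousLinearEquiv.finTwoArrow ℝ ℝ)
  have he1 : ∀ x, (e x).1 = ⟪x, ξ⟫ := by
    intro x
    have : (e x).1 = b.repr x 0 := rfl
    rw [this, b.repr_apply_apply, hb0, real_inner_comm]
  have hmp : MeasurePreserving e volume volume :=
    ((volume_preserving_finTwoArrow ℝ).comp
      (PiLp.volume_preserving_ofLp (Fin 2))).comp b.measurePreserving_repr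
  have hemb : MeasurableEmbedding e := e.toHomeomorph.measurableEmbedding
  have himg : ∀ s, volume (e '' s) = volume s := by
    intro s
    rw [← hmp.measure_preimage_emb hemb, preimage_image_eq _ e.injective]
  have hKfin : volume K < ⊤ := hKcomp.measure_lt_top
  have hKpos : 0 < volume K := Measure.measure_pos_of_nonempty_interior _ hKint
  have hcen : ∫ p in e '' K, p.1 = 0 := by
    rw [hmp.setIntegral_image_emb hemb]
    simp only [he1]
    have hi : IntegrableOn (fun x : EuclideanSpace ℝ (Fin 2) => x) K :=
      continuous_id.continuousOn.integrableOn_compact hKcomp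
    have := integral_inner (𝕜 := ℝ) hi ξ
    rw [hcentroid, inner_zero_right] at this
    simpa only [real_inner_comm] using this
  have main := gr_plane (e '' K) (hKconv.linear_image e.toLinearEquiv.toLinearMap)
    (hKcomp.image e.continuous)
    (by rw [measureReal_def, himg]; exact ENNReal.toReal_pos hKpos.ne' hKfin.ne) hcen
  have hset : e '' K ∩ {p | 0 ≤ p.1} = e '' (K ∩ {x | 0 ≤ ⟪x, ξ⟫}) := by
    ext p
    constructor
    · rintro ⟨⟨x, hx, rfl⟩, h⟩
      exact ⟨x, ⟨hx, by simpa only [mem_ofPred_eq, he1] using h⟩, rfl⟩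
    · rintro ⟨x, ⟨hx, h⟩, rfl⟩
      exact ⟨⟨x, hx, rfl⟩, by simpa only [mem_ofPred_eq, he1] using h⟩
  rw [hset, measureReal_def, measureReal_def, himg, himg] at main
  have hfin2 : volume (K ∩ {x | 0 ≤ ⟪x, ξ⟫}) ≠ ⊤ :=
    ((measure_mono inter_subset_left).trans_lt hKfin).ne
  rw [← ENNReal.ofReal_toReal hKfin.ne, ← ENNReal.ofReal_toReal hfin2,
    ← ENNReal.ofReal_mul (by norm_num)]
  exact ENNReal.ofReal_le_ofReal main
end

section
/- Let 1 ≤ i ≤ k < n be integers, K ⊂ ℝⁿ a convex body with centroid at the origin, and E a k-dimensional linear subspace. Then the i-th intrinsic volume satisfies V_i(K ∩ E) ≥ ((i+1)/(n+1))^i · max_{x ∈ K} V_i((K − x) ∩ E). -/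
open MeasureTheory
open scoped Pointwise

/-- The volume of the `m`-dimensional Euclidean unit ball. -/
noncomputable def kappa (m : ℕ) : ℝ :=
  (volume (Metric.closedBall (0 : EuclideanSpace ℝ (Fin m)) 1)).toReal

lemma bm_one_compact {A B C : Set ℝ} (hA : IsCompact A) (hB : IsCompact B)
    (hAne : A.Nonempty) (hBne : B.Nonempty)
    (h : ∀ a ∈ A, ∀ b ∈ B, a + b ∈ C) : volume A + volume B ≤ volume C := by
  obtain ⟨a, ha, hamax⟩ := hA.exists_isGreatest hAne
  obtain ⟨b, hb, hbmin⟩ := hB.exists_isLeast hBne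
  have h1 : volume ((fun x => x + b) '' A) = volume A := by
    rw [Set.image_add_right, measure_preimage_add_right]
  have h2 : volume ((fun x => a + x) '' B) = volume B := by
    rw [Set.image_add_left, measure_preimage_add]
  have hd : AEDisjoint volume ((fun x => x + b) '' A) ((fun x => a + x) '' B) := by
    refine measure_mono_null (t := {a + b}) ?_ (by simp)
    rintro x ⟨⟨y, hy, rfl⟩, ⟨z, hz, hzz⟩⟩
    have := hamax hy
    have := hbmin hz
    simp only [Set.mem_singleton_iff]
    simp only at hzz
    linarith
  have hm : NullMeasurableSet ((fun x => a + x) '' B) :=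
    ((hB.image (by fun_prop)).measurableSet).nullMeasurableSet
  rw [← h1, ← h2, ← measure_union₀ hm hd]
  apply measure_mono
  rintro x (⟨y, hy, rfl⟩ | ⟨y, hy, rfl⟩)
  · exact h _ hy _ hb
  · exact h _ ha _ hy

lemma bm_one {A B C : Set ℝ} (hA : MeasurableSet A) (hB : MeasurableSet B)
    (hAne : A.Nonempty) (hBne : B.Nonempty)
    (h : ∀ a ∈ A, ∀ b ∈ B, a + b ∈ C) : volume A + volume B ≤ volume C := by
  obtain ⟨a, ha⟩ := hAne
  obtain ⟨b, hb⟩ := hBne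
  have s1 : ∀ B' ⊆ B, IsCompact B' → B'.Nonempty → volume A + volume B' ≤ volume C := by
    intro B' hB' hc hne
    have hfin := hc.measure_lt_top (μ := volume)
    by_cases htop : volume C = ⊤
    · simp [htop]
    have : volume A ≤ volume C - volume B' := by
      rw [hA.measure_eq_iSup_isCompact]
      refine iSup_le fun K => iSup_le fun hK => iSup_le fun hKc => ?_
      refine (measure_mono Set.subset_union_left).trans
        (ENNReal.le_sub_of_add_le_right hfin.ne
          (bm_one_compact (A := K ∪ {a}) (hKc.union isCompact_singleton) hc ⟨a, by simp⟩ hne ?_))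
      rintro x (hx | hx) y hy
      · exact h _ (hK hx) _ (hB' hy)
      · rw [Set.mem_singleton_iff.1 hx]; exact h _ ha _ (hB' hy)
    have h3 : volume B' ≤ volume C := by
      have := bm_one_compact (A := {a}) (B := B') (C := C) isCompact_singleton hc ⟨a, by simp⟩ hne ?_
      · exact le_trans (by simp) this
      · rintro x hx y hy
        rw [Set.mem_singleton_iff.1 hx]; exact h _ ha _ (hB' hy)
    calc volume A + volume B' ≤ volume C - volume B' + volume B' := by gcongr
      _ = volume C := tsub_add_cancel_of_le h3
  have h0 : volume A ≤ volume C :=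
    le_trans (by simp) (s1 {b} (by simpa using hb) isCompact_singleton ⟨b, by simp⟩)
  by_cases htop : volume A = ⊤
  · rw [htop, top_le_iff] at h0
    simp [h0]
  have : volume B ≤ volume C - volume A := by
    rw [hB.measure_eq_iSup_isCompact]
    refine iSup_le fun K => iSup_le fun hK => iSup_le fun hKc => ?_
    refine (measure_mono Set.subset_union_left).trans
      (ENNReal.le_sub_of_add_le_left htop
        (s1 (K ∪ {b}) ?_ (hKc.union isCompact_singleton) ⟨b, by simp⟩))
    rintro x (hx | hx)
    · exact hK hx
    · rw [Set.mem_singleton_iff.1 hx]; exact hb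
  calc volume A + volume B ≤ volume A + (volume C - volume A) := by gcongr
    _ = volume C := add_tsub_cancel_of_le h0

lemma level_int {f : ℝ → ℝ} (hf : Measurable f) (h0 : ∀ x, 0 ≤ f x) (h1 : ∀ x, f x ≤ 1) :
    ∫⁻ x, ENNReal.ofReal (f x) = ∫⁻ s in Set.Ioo 0 1, volume {x | s < f x} := by
  rw [lintegral_eq_lintegral_meas_lt volume (Filter.Eventually.of_forall h0) hf.aemeasurable]
  rw [← Set.Ioo_union_Ici_eq_Ioi (zero_lt_one' ℝ), lintegral_union measurableSet_Ici]
  · rw [setLIntegral_congr_fun (g := fun _ => 0) measurableSet_Ici]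
    · simp
    · intro s hs
      have : {x | s < f x} = ∅ := by
        ext x; simp only [Set.mem_ofPred_eq, Set.mem_empty_iff_false, iff_false, not_lt]
        exact (h1 x).trans hs
      simp [this]
  · rw [Set.disjoint_left]
    rintro x ⟨_, hx⟩ hx'
    exact absurd hx (not_lt.2 hx')

/-- one-dimensional Prekopa-Leindler -/
lemma pl_one {f g h : ℝ → ℝ} (hf : Measurable f) (hg : Measurable g) (hh : Measurable h)
    (f0 : ∀ x, 0 ≤ f x) (g0 : ∀ x, 0 ≤ g x) (h0 : ∀ x, 0 ≤ h x)
    (fb : BddAbove (Set.range f)) (gb : BddAbove (Set.range g))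
    (fi : ∫⁻ x, ENNReal.ofReal (f x) ≠ ⊤) (gi : ∫⁻ x, ENNReal.ofReal (g x) ≠ ⊤)
    (hi : ∫⁻ x, ENNReal.ofReal (h x) ≠ ⊤)
    {l : ℝ} (hl0 : 0 < l) (hl1 : l < 1)
    (H : ∀ x y, f x ^ (1 - l) * g y ^ l ≤ h ((1 - l) * x + l * y)) :
    (∫⁻ x, ENNReal.ofReal (f x)).toReal ^ (1 - l) * (∫⁻ x, ENNReal.ofReal (g x)).toReal ^ l
      ≤ (∫⁻ x, ENNReal.ofReal (h x)).toReal := by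
  set F := ⨆ x, f x with hF
  set G := ⨆ x, g x with hG
  have fF : ∀ x, f x ≤ F := fun x => le_ciSup fb x
  have gG : ∀ x, g x ≤ G := fun x => le_ciSup gb x
  have F0 : 0 ≤ F := (f0 0).trans (fF 0)
  have G0 : 0 ≤ G := (g0 0).trans (gG 0)
  rcases F0.eq_or_lt with hF0 | hF0
  · have : ∀ x, f x = 0 := fun x => le_antisymm (hF0 ▸ fF x) (f0 x)
    simp [this, Real.zero_rpow (sub_pos.2 hl1).ne']
  rcases G0.eq_or_lt with hG0 | hG0
  · have : ∀ x, g x = 0 := fun x => le_antisymm (hG0 ▸ gG x) (g0 x)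
    simp [this, Real.zero_rpow hl0.ne']
  set M := F ^ (1 - l) * G ^ l with hM
  have M0 : 0 < M := by positivity
  have key : ∀ s ∈ Set.Ioo (0:ℝ) 1, ENNReal.ofReal (1 - l) * volume {x | s < f x / F} +
      ENNReal.ofReal l * volume {x | s < g x / G} ≤ volume {x | s < h x / M} := by
    rintro s ⟨hs0, hs1⟩
    have e1 : ENNReal.ofReal (1 - l) * volume {x | s < f x / F}
        = volume ((1 - l) • {x | s < f x / F}) := by
      rw [Measure.addHaar_smul]; simp [abs_of_pos (sub_pos.2 hl1)]
    have e2 : ENNReal.ofReal l * volume {x | s < g x / G}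
        = volume (l • {x | s < g x / G}) := by
      rw [Measure.addHaar_smul]; simp [abs_of_pos hl0]
    rw [e1, e2]
    apply bm_one
    · exact MeasurableSet.const_smul₀ (measurableSet_lt measurable_const (hf.div_const _)) _
    · exact MeasurableSet.const_smul₀ (measurableSet_lt measurable_const (hg.div_const _)) _
    · have : s * F < F := by nlinarith
      obtain ⟨x, hx⟩ := exists_lt_of_lt_ciSup this
      exact Set.Nonempty.smul_set (s := {x | s < f x / F}) ⟨x, by simpa [lt_div_iff₀ hF0] using hx⟩
    · have : s * G < G := by nlinarith
      obtain ⟨x, hx⟩ := exists_lt_of_lt_ciSup this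
      exact Set.Nonempty.smul_set (s := {x | s < g x / G}) ⟨x, by simpa [lt_div_iff₀ hG0] using hx⟩
    · rintro _ ⟨x, hx, rfl⟩ _ ⟨y, hy, rfl⟩
      simp only [Set.mem_ofPred_eq, smul_eq_mul] at *
      rw [lt_div_iff₀ hF0] at hx
      rw [lt_div_iff₀ hG0] at hy
      rw [lt_div_iff₀ M0]
      refine lt_of_lt_of_le ?_ (H x y)
      have : s * M = (s * F) ^ (1 - l) * (s * G) ^ l := by
        rw [Real.mul_rpow hs0.le F0, Real.mul_rpow hs0.le G0, hM]
        have : s = s ^ (1 - l) * s ^ l := by rw [← Real.rpow_add hs0]; simp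
        nth_rewrite 1 [this]; ring
      rw [this]
      have a1 := Real.rpow_lt_rpow (by positivity) hx (sub_pos.2 hl1)
      have a2 := Real.rpow_lt_rpow (by positivity) hy hl0
      exact mul_lt_mul'' a1 a2 (by positivity) (by positivity)
  have sc : ∀ (u : ℝ → ℝ) (c : ℝ), 0 < c → (∫⁻ x, ENNReal.ofReal (u x / c)).toReal
      = (∫⁻ x, ENNReal.ofReal (u x)).toReal / c := by
    intro u c hc
    simp_rw [ENNReal.ofReal_div_of_pos hc, div_eq_mul_inv]
    rw [lintegral_mul_const' _ _ (by simp [hc]), ENNReal.toReal_mul, ENNReal.toReal_inv,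
      ENNReal.toReal_ofReal hc.le]
  have fin : ∀ (u : ℝ → ℝ) (c : ℝ), 0 < c → ∫⁻ x, ENNReal.ofReal (u x) ≠ ⊤ →
      (∫⁻ x, ENNReal.ofReal (u x / c)) ≠ ⊤ := by
    intro u c hc hu
    simp_rw [ENNReal.ofReal_div_of_pos hc, div_eq_mul_inv]
    rw [lintegral_mul_const' _ _ (by simp [hc])]
    exact ENNReal.mul_ne_top hu (by simp [hc])
  have main : ENNReal.ofReal (1 - l) * (∫⁻ x, ENNReal.ofReal (f x / F)) +
      ENNReal.ofReal l * (∫⁻ x, ENNReal.ofReal (g x / G)) ≤ ∫⁻ x, ENNReal.ofReal (h x / M) := by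
    rw [level_int (hf.div_const _) (fun x => div_nonneg (f0 x) F0)
        (fun x => div_le_one_of_le₀ (fF x) F0),
      level_int (hg.div_const _) (fun x => div_nonneg (g0 x) G0)
        (fun x => div_le_one_of_le₀ (gG x) G0),
      lintegral_eq_lintegral_meas_lt volume (f := fun x => h x / M)
        (Filter.Eventually.of_forall fun x => div_nonneg (h0 x) M0.le)
        (hh.div_const _).aemeasurable]
    have ma : Measurable fun s => volume {x | s < f x / F} :=
      Antitone.measurable fun s t hst => measure_mono fun x hx => lt_of_le_of_lt hst hx
    have mb : Measurable fun s => volume {x | s < g x / G} :=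
      Antitone.measurable fun s t hst => measure_mono fun x hx => lt_of_le_of_lt hst hx
    rw [← lintegral_const_mul _ ma, ← lintegral_const_mul _ mb,
      ← lintegral_add_left (ma.const_mul _)]
    refine (setLIntegral_mono' measurableSet_Ioo key).trans ?_
    exact lintegral_mono_set Set.Ioo_subset_Ioi_self
  have main' := ENNReal.toReal_mono (fin h M M0 hi) main
  rw [ENNReal.toReal_add (ENNReal.mul_ne_top (by simp) (fin f F hF0 fi))
    (ENNReal.mul_ne_top (by simp) (fin g G hG0 gi)), ENNReal.toReal_mul, ENNReal.toReal_mul,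
    sc _ _ hF0, sc _ _ hG0, sc _ _ M0, ENNReal.toReal_ofReal hl0.le,
    ENNReal.toReal_ofReal (sub_pos.2 hl1).le, le_div_iff₀ M0] at main'
  refine le_trans ?_ main'
  set a := (∫⁻ x, ENNReal.ofReal (f x)).toReal
  set b := (∫⁻ x, ENNReal.ofReal (g x)).toReal
  have a0 : 0 ≤ a := ENNReal.toReal_nonneg
  have b0 : 0 ≤ b := ENNReal.toReal_nonneg
  have := Real.geom_mean_le_arith_mean2_weighted (sub_pos.2 hl1).le hl0.le
    (div_nonneg a0 F0) (div_nonneg b0 G0) (by ring)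
  calc a ^ (1 - l) * b ^ l = (a / F) ^ (1 - l) * (b / G) ^ l * M := by
        rw [Real.div_rpow a0 F0, Real.div_rpow b0 G0, hM]
        field_simp
    _ ≤ _ := by gcongr

lemma slice_facts {d : ℕ} {A : Set (Fin (d + 1) → ℝ)} (hA : MeasurableSet A)
    (hb : Bornology.IsBounded A) :
    (∀ t, MeasurableSet {y : Fin d → ℝ | (Fin.cons t y : Fin (d + 1) → ℝ) ∈ A}) ∧
    (∀ t, Bornology.IsBounded {y : Fin d → ℝ | (Fin.cons t y : Fin (d + 1) → ℝ) ∈ A}) ∧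
    Measurable (fun t => (volume {y : Fin d → ℝ | (Fin.cons t y : Fin (d + 1) → ℝ) ∈ A}).toReal) ∧
    BddAbove (Set.range
      (fun t => (volume {y : Fin d → ℝ | (Fin.cons t y : Fin (d + 1) → ℝ) ∈ A}).toReal)) ∧
    ∫⁻ t, ENNReal.ofReal
      (volume {y : Fin d → ℝ | (Fin.cons t y : Fin (d + 1) → ℝ) ∈ A}).toReal = volume A := by
  have hmp := (volume_preserving_piFinSuccAbove (fun _ : Fin (d + 1) => ℝ) 0).symm
  set e := (MeasurableEquiv.piFinSuccAbove (fun _ : Fin (d + 1) => ℝ) 0).symm with he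
  have hpre : ∀ t, {y : Fin d → ℝ | (Fin.cons t y : Fin (d + 1) → ℝ) ∈ A}
      = Prod.mk t ⁻¹' (e ⁻¹' A) := by
    intro t
    ext y
    simp [he, MeasurableEquiv.piFinSuccAbove]
    rfl
  have hA' : MeasurableSet (e ⁻¹' A) := e.measurable hA
  obtain ⟨R, hR⟩ := hb.subset_closedBall 0
  have hsub : ∀ t, {y : Fin d → ℝ | (Fin.cons t y : Fin (d + 1) → ℝ) ∈ A} ⊆
      Metric.closedBall 0 R := by
    intro t y hy
    have h1 : (Fin.cons t y : Fin (d + 1) → ℝ) ∈ Metric.closedBall 0 R := hR hy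
    rw [mem_closedBall_zero_iff] at h1 ⊢
    have hR0 : 0 ≤ R := (norm_nonneg _).trans h1
    rw [pi_norm_le_iff_of_nonneg hR0] at h1 ⊢
    intro i
    simpa using h1 i.succ
  have hfin : volume (Metric.closedBall (0 : Fin d → ℝ) R) ≠ ⊤ := measure_closedBall_lt_top.ne
  refine ⟨?_, ?_, ?_, ?_, ?_⟩
  · intro t; rw [hpre]; exact measurable_prodMk_left hA'
  · intro t; exact Metric.isBounded_closedBall.subset (hsub t)
  · simp_rw [hpre]
    exact (measurable_measure_prodMk_left hA').ennreal_toReal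
  · refine ⟨(volume (Metric.closedBall (0 : Fin d → ℝ) R)).toReal, ?_⟩
    rintro _ ⟨t, rfl⟩
    exact ENNReal.toReal_mono hfin (measure_mono (hsub t))
  · have : ∀ t, ENNReal.ofReal
      (volume {y : Fin d → ℝ | (Fin.cons t y : Fin (d + 1) → ℝ) ∈ A}).toReal
      = volume (Prod.mk t ⁻¹' (e ⁻¹' A)) := by
      intro t
      rw [ENNReal.ofReal_toReal, hpre]
      exact ne_top_of_le_ne_top hfin (measure_mono (hsub t))
    simp_rw [this]
    rw [← hmp.measure_preimage_equiv A]
    exact (Measure.prod_apply hA').symm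

lemma bm_mul {l : ℝ} (hl0 : 0 < l) (hl1 : l < 1) (d : ℕ) : ∀ (A B C : Set (Fin d → ℝ)),
    MeasurableSet A → MeasurableSet B → MeasurableSet C →
    Bornology.IsBounded A → Bornology.IsBounded B → Bornology.IsBounded C →
    (∀ a ∈ A, ∀ b ∈ B, (1 - l) • a + l • b ∈ C) →
    (volume A).toReal ^ (1 - l) * (volume B).toReal ^ l ≤ (volume C).toReal := by
  induction d with
  | zero =>
    intro A B C _ _ _ _ _ _ h
    rcases A.eq_empty_or_nonempty with rfl | ⟨a, ha⟩
    · simp [Real.zero_rpow (sub_pos.2 hl1).ne']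
    rcases B.eq_empty_or_nonempty with rfl | ⟨b, hb⟩
    · simp [Real.zero_rpow hl0.ne']
    have hA : A = Set.univ := Subsingleton.eq_univ_of_nonempty ⟨a, ha⟩
    have hB : B = Set.univ := Subsingleton.eq_univ_of_nonempty ⟨b, hb⟩
    have hC : C = Set.univ := Subsingleton.eq_univ_of_nonempty ⟨_, h _ ha _ hb⟩
    have : volume (Set.univ : Set (Fin 0 → ℝ)) = 1 := by
      rw [volume_pi, Measure.pi_of_empty _ 0]; simp
    rw [hA, hB, hC, this]
    simp
  | succ d ih =>
    intro A B C mA mB mC bA bB bC h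
    obtain ⟨a1, a2, a3, a4, a5⟩ := slice_facts mA bA
    obtain ⟨b1, b2, b3, b4, b5⟩ := slice_facts mB bB
    obtain ⟨c1, c2, c3, c4, c5⟩ := slice_facts mC bC
    rw [← a5, ← b5, ← c5]
    refine pl_one a3 b3 c3 (fun _ => ENNReal.toReal_nonneg) (fun _ => ENNReal.toReal_nonneg)
      (fun _ => ENNReal.toReal_nonneg) a4 b4 ?_ ?_ ?_ hl0 hl1 ?_
    · rw [a5]; exact bA.measure_lt_top.ne
    · rw [b5]; exact bB.measure_lt_top.ne
    · rw [c5]; exact bC.measure_lt_top.ne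
    · intro x y
      refine ih _ _ _ (a1 _) (b1 _) (c1 _) (a2 _) (b2 _) (c2 _) ?_
      intro a ha b hb
      have := h _ ha _ hb
      simp only [Set.mem_ofPred_eq]
      convert this using 1
      ext i
      refine Fin.cases ?_ (fun j => ?_) i <;> simp

/-- volume radius -/
noncomputable def vrad {d : ℕ} (A : Set (Fin d → ℝ)) : ℝ := (volume A).toReal ^ ((d : ℝ)⁻¹)

lemma vrad_nonneg {d : ℕ} (A : Set (Fin d → ℝ)) : 0 ≤ vrad A :=
  Real.rpow_nonneg ENNReal.toReal_nonneg _

lemma vrad_pow {d : ℕ} (hd : 1 ≤ d) (A : Set (Fin d → ℝ)) : vrad A ^ d = (volume A).toReal := by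
  rw [vrad, Real.rpow_inv_natCast_pow ENNReal.toReal_nonneg (by omega)]

lemma vrad_mono {d : ℕ} {A B : Set (Fin d → ℝ)} (h : A ⊆ B) (hB : Bornology.IsBounded B) :
    vrad A ≤ vrad B := by
  unfold vrad
  have := ENNReal.toReal_mono hB.measure_lt_top.ne (measure_mono (μ := volume) h)
  gcongr

lemma toReal_vol_smul {d : ℕ} (A : Set (Fin d → ℝ)) {r : ℝ} (hr : 0 ≤ r) :
    (volume (r • A)).toReal = r ^ d * (volume A).toReal := by
  rw [Measure.addHaar_smul]
  simp [abs_of_nonneg hr, ENNReal.toReal_ofReal (pow_nonneg hr d)]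

lemma vrad_aux {d : ℕ} (hd : 1 ≤ d) {B C : Set (Fin d → ℝ)} (bC : Bornology.IsBounded C)
    {β : ℝ} (hβ : 0 < β) (v : Fin d → ℝ) (h : ∀ b ∈ B, v + β • b ∈ C) :
    β * vrad B ≤ vrad C := by
  have h1 : volume ((fun x => v + x) '' (β • B)) ≤ volume C := by
    apply measure_mono
    rintro _ ⟨_, ⟨b, hb, rfl⟩, rfl⟩
    exact h b hb
  rw [Set.image_add_left, measure_preimage_add] at h1
  have h2 := ENNReal.toReal_mono bC.measure_lt_top.ne h1
  rw [toReal_vol_smul _ hβ.le, ← vrad_pow hd, ← vrad_pow hd, ← mul_pow] at h2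
  exact le_of_pow_le_pow_left₀ (by omega) (vrad_nonneg _) h2

lemma bm_add {d : ℕ} (hd : 1 ≤ d) {A B C : Set (Fin d → ℝ)}
    (mA : MeasurableSet A) (mB : MeasurableSet B) (mC : MeasurableSet C)
    (bA : Bornology.IsBounded A) (bB : Bornology.IsBounded B) (bC : Bornology.IsBounded C)
    (nA : A.Nonempty) (nB : B.Nonempty) {α β : ℝ} (hα : 0 < α) (hβ : 0 < β)
    (h : ∀ a ∈ A, ∀ b ∈ B, α • a + β • b ∈ C) : α * vrad A + β * vrad B ≤ vrad C := by
  obtain ⟨a, ha⟩ := nA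
  obtain ⟨b, hb⟩ := nB
  rcases (vrad_nonneg A).eq_or_lt with h0 | hA0
  · rw [← h0, mul_zero, zero_add]
    exact vrad_aux hd bC hβ (α • a) (fun b hb => h a ha b hb)
  rcases (vrad_nonneg B).eq_or_lt with h0 | hB0
  · rw [← h0, mul_zero, add_zero]
    exact vrad_aux hd bC hα (β • b) (fun a ha => by rw [add_comm]; exact h a ha b hb)
  set p := α * vrad A with hp
  set q := β * vrad B with hq
  have p0 : 0 < p := by positivity
  have q0 : 0 < q := by positivity
  have := bm_mul (l := q / (p + q)) (by positivity) (by rw [div_lt_one (by positivity)]; linarith) d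
    ((vrad A)⁻¹ • A) ((vrad B)⁻¹ • B) ((p + q)⁻¹ • C) (mA.const_smul₀ _) (mB.const_smul₀ _)
    (mC.const_smul₀ _) (bA.smul₀ _) (bB.smul₀ _) (bC.smul₀ _) ?_
  · rw [toReal_vol_smul _ (by positivity), toReal_vol_smul _ (by positivity),
      toReal_vol_smul _ (by positivity), ← vrad_pow hd, ← vrad_pow hd, ← vrad_pow hd,
      ← mul_pow, ← mul_pow, ← mul_pow, inv_mul_cancel₀ hA0.ne', inv_mul_cancel₀ hB0.ne'] at this
    simp only [one_pow, Real.one_rpow, mul_one] at this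
    have h1 : 1 ≤ (p + q)⁻¹ * vrad C := by
      by_contra hlt
      push Not at hlt
      have := pow_lt_one₀ (mul_nonneg (by positivity) (vrad_nonneg C)) hlt (n := d) (by omega)
      linarith
    rw [inv_mul_eq_div, le_div_iff₀ (by positivity)] at h1
    linarith
  · rintro _ ⟨a, ha, rfl⟩ _ ⟨b, hb, rfl⟩
    refine ⟨_, h a ha b hb, ?_⟩
    simp only [smul_add, smul_smul]
    congr 2
    · rw [hp]; field_simp; ring
    · rw [hq]; field_simp

section core
variable {m i l : ℕ}

def secA (K : Set (((Fin m → ℝ) × (Fin i → ℝ)) × (Fin l → ℝ))) (x : Fin m → ℝ) :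
    Set (Fin i → ℝ) := {y | ∃ z, ((x, y), z) ∈ K}

noncomputable def gfun (K : Set (((Fin m → ℝ) × (Fin i → ℝ)) × (Fin l → ℝ)))
    (p : (Fin m → ℝ) × (Fin i → ℝ)) : ℝ := (volume (Prod.mk p ⁻¹' K)).toReal

def secD (K : Set (((Fin m → ℝ) × (Fin i → ℝ)) × (Fin l → ℝ))) (x : Fin m → ℝ) (s : ℝ) :
    Set (Fin i → ℝ) := {y | s < gfun K (x, y)}

variable {K : Set (((Fin m → ℝ) × (Fin i → ℝ)) × (Fin l → ℝ))}

lemma secA_eq (x : Fin m → ℝ) : secA K x = Prod.mk x ⁻¹' (Prod.fst '' K) := by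
  ext y
  simp [secA]

lemma secA_closed (hK : IsCompact K) (x : Fin m → ℝ) : IsClosed (secA K x) := by
  rw [secA_eq]
  exact (hK.image continuous_fst).isClosed.preimage (by fun_prop)

lemma secA_sub (x : Fin m → ℝ) : secA K x ⊆ (fun p => p.1.2) '' K := by
  rintro y ⟨z, hz⟩
  exact ⟨_, hz, rfl⟩

lemma secA_bdd (hK : IsCompact K) (x : Fin m → ℝ) : Bornology.IsBounded (secA K x) :=
  (hK.image (by fun_prop)).isBounded.subset (secA_sub x)

lemma gfun_meas (hK : IsCompact K) : Measurable (gfun K) :=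
  (measurable_measure_prodMk_left hK.measurableSet).ennreal_toReal

lemma fib_compact (hK : IsCompact K) (p : (Fin m → ℝ) × (Fin i → ℝ)) :
    IsCompact (Prod.mk p ⁻¹' K) := by
  apply Metric.isCompact_of_isClosed_isBounded
  · exact hK.isClosed.preimage (by fun_prop)
  · refine (hK.image continuous_snd).isBounded.subset ?_
    intro z hz
    exact ⟨_, hz, rfl⟩

lemma secD_meas (hK : IsCompact K) (x : Fin m → ℝ) (s : ℝ) : MeasurableSet (secD K x s) :=
  measurableSet_lt measurable_const ((gfun_meas hK).comp measurable_prodMk_left)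

lemma secD_sub {x : Fin m → ℝ} {s : ℝ} (hs : 0 ≤ s) : secD K x s ⊆ secA K x := by
  intro y hy
  have h1 : 0 < gfun K (x, y) := lt_of_le_of_lt hs hy
  have h2 : volume (Prod.mk (x, y) ⁻¹' K) ≠ 0 := by
    intro h; simp [gfun, h] at h1
  obtain ⟨z, hz⟩ := nonempty_of_measure_ne_zero h2
  exact ⟨z, hz⟩

lemma secD_bdd (hK : IsCompact K) {x : Fin m → ℝ} {s : ℝ} (hs : 0 ≤ s) :
    Bornology.IsBounded (secD K x s) := (secA_bdd hK x).subset (secD_sub hs)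

lemma secA_comb (hc : Convex ℝ K) {x x0 : Fin m → ℝ} {a b : ℝ} (ha : 0 ≤ a) (hb : 0 ≤ b)
    (hab : a + b = 1) : ∀ y ∈ secA K x, ∀ y0 ∈ secA K x0,
      a • y + b • y0 ∈ secA K (a • x + b • x0) := by
  rintro y ⟨z, hz⟩ y0 ⟨z0, hz0⟩
  exact ⟨a • z + b • z0, hc hz hz0 ha hb hab⟩

lemma secD_comb (hK : IsCompact K) (hc : Convex ℝ K) {x x0 : Fin m → ℝ} {a b : ℝ} (ha : 0 < a)
    (hb : 0 ≤ b) (hab : a + b = 1) {s : ℝ} : ∀ y ∈ secD K x s, ∀ y0 ∈ secA K x0,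
      a • y + b • y0 ∈ secD K (a • x + b • x0) (a ^ l * s) := by
  rintro y hy y0 ⟨z0, hz0⟩
  have hy' : s < gfun K (x, y) := hy
  change a ^ l * s < gfun K (a • x + b • x0, a • y + b • y0)
  have h1 : a ^ l * gfun K (x, y) ≤ gfun K (a • x + b • x0, a • y + b • y0) := by
    unfold gfun
    rw [← toReal_vol_smul _ ha.le]
    apply ENNReal.toReal_mono (fib_compact hK _).measure_lt_top.ne
    rw [← measure_preimage_add volume (-(b • z0)) (a • (Prod.mk (x, y) ⁻¹' K))]
    apply measure_mono
    rintro w ⟨z, hz, hzw⟩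
    have hz' : ((x, y), z) ∈ K := hz
    have := hc hz' hz0 ha.le hb hab
    have e : w = a • z + b • z0 := by
      have : a • z = -(b • z0) + w := hzw
      rw [this]; abel
    rw [e]
    exact this
  have : 0 < a ^ l := by positivity
  nlinarith

lemma core_layer (hK : IsCompact K) {F : (Fin m → ℝ) → ENNReal} (hF : Measurable F) :
    ∫⁻ p in K, F p.1.1 = ∫⁻ x, ∫⁻ s in Set.Ioi (0:ℝ), F x * volume (secD K x s) := by
  have hg := gfun_meas hK
  have mF : Measurable fun p : ((Fin m → ℝ) × (Fin i → ℝ)) × (Fin l → ℝ) => F p.1.1 := by fun_prop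
  rw [← lintegral_indicator hK.measurableSet]
  have e1 := lintegral_prod (μ := (volume : Measure ((Fin m → ℝ) × (Fin i → ℝ))))
    (ν := (volume : Measure (Fin l → ℝ))) (K.indicator fun p => F p.1.1)
    (mF.indicator hK.measurableSet).aemeasurable
  refine e1.trans ?_
  have e2 : ∀ q : (Fin m → ℝ) × (Fin i → ℝ), ∫⁻ z, K.indicator (fun p => F p.1.1) (q, z)
      = F q.1 * ENNReal.ofReal (gfun K q) := by
    intro q
    have : (fun z => K.indicator (fun p => F p.1.1) (q, z))
        = (Prod.mk q ⁻¹' K).indicator (fun _ => F q.1) := by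
      ext z; simp [Set.indicator]; rfl
    rw [this, lintegral_indicator (fib_compact hK q).measurableSet, setLIntegral_const, gfun,
      ENNReal.ofReal_toReal (fib_compact hK q).measure_lt_top.ne]
  simp_rw [e2]
  have e3 := lintegral_prod (μ := (volume : Measure (Fin m → ℝ)))
    (ν := (volume : Measure (Fin i → ℝ))) (fun q => F q.1 * ENNReal.ofReal (gfun K q))
    ((hF.comp measurable_fst).mul hg.ennreal_ofReal).aemeasurable
  refine e3.trans ?_
  refine lintegral_congr fun x => ?_
  have hgx : Measurable fun y => gfun K (x, y) := hg.comp measurable_prodMk_left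
  change ∫⁻ y, F x * ENNReal.ofReal (gfun K (x, y)) = _
  rw [lintegral_const_mul _ hgx.ennreal_ofReal, lintegral_const_mul,
    lintegral_eq_lintegral_meas_lt (f := fun y => gfun K (x, y)) volume
      (Filter.Eventually.of_forall fun y => ENNReal.toReal_nonneg) hgx.aemeasurable]
  · rfl
  · exact Antitone.measurable fun s t hst => measure_mono fun x hx => lt_of_le_of_lt hst hx

lemma lint_scale {E : Type*} [NormedAddCommGroup E] [NormedSpace ℝ E] [MeasurableSpace E]
    [BorelSpace E] [FiniteDimensional ℝ E] (μ : Measure E) [μ.IsAddHaarMeasure]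
    {r : ℝ} (hr : 0 < r) (v : E) (w : E → ENNReal) :
    ∫⁻ x, w x ∂μ = ENNReal.ofReal (r ^ Module.finrank ℝ E) * ∫⁻ x, w (r • x + v) ∂μ := by
  have h1 : ∫⁻ x, w (r • x + v) ∂μ = ∫⁻ x, w (x + v) ∂(Measure.map (r • ·) μ) := by
    exact ((Homeomorph.smulOfNeZero (α := E) r
      hr.ne').toMeasurableEquiv.measurableEmbedding.lintegral_map (μ := μ)
        (fun x => w (x + v))).symm
  rw [h1, Measure.map_addHaar_smul μ hr.ne', lintegral_smul_measure, lintegral_add_right_eq_self,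
    smul_eq_mul, ← mul_assoc, ← ENNReal.ofReal_mul (by positivity),
    abs_of_pos (by positivity), mul_inv_cancel₀ (by positivity), ENNReal.ofReal_one, one_mul]

lemma lint_scale_Ioi {c : ℝ} (hc : 0 < c) (w : ℝ → ENNReal) :
    ∫⁻ s in Set.Ioi (0:ℝ), w s = ENNReal.ofReal c * ∫⁻ s in Set.Ioi (0:ℝ), w (c * s) := by
  rw [← lintegral_indicator measurableSet_Ioi, ← lintegral_indicator measurableSet_Ioi,
    lint_scale volume hc 0]
  simp only [Module.finrank_self, pow_one, add_zero, smul_eq_mul]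
  congr 2
  ext s
  simp [Set.indicator, hc]

lemma pointwise_ineq {i : ℕ} (hi : 1 ≤ i) {e f d M f' d' : ℝ} (he0 : 0 < e) (he1 : e < 1)
    (hM : 0 ≤ M) (hd : 0 < d) (hdf : d ≤ f) (hf' : (1 - e) * f + e * M ≤ f')
    (hd' : (1 - e) * d + e * M ≤ d') :
    (1 - e) ^ (i + 1) * (f * d ^ i) + (1 - e) ^ i * (i + 1) * e * M * d ^ i ≤ f' * d' ^ i := by
  have h1e : 0 < 1 - e := by linarith
  have hf : 0 < f := hd.trans_le hdf
  set a := (1 - e) * d with ha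
  set b := e * M with hb
  have a0 : 0 < a := by positivity
  have b0 : 0 ≤ b := by positivity
  have h1 : a ^ i * (1 + i * (b / a)) ≤ (a + b) ^ i := by
    have := one_add_mul_le_pow (a := b / a) (by have : 0 ≤ b / a := by positivity
                                                linarith) i
    calc a ^ i * (1 + i * (b / a)) ≤ a ^ i * (1 + b / a) ^ i := by gcongr
      _ = (a + b) ^ i := by rw [← mul_pow]; congr 1; field_simp
  have h2 : ((1 - e) * f + b) * (a ^ i * (1 + i * (b / a))) ≤ f' * d' ^ i := by
    apply mul_le_mul hf' (h1.trans (by gcongr)) (by positivity)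
    exact le_trans (by positivity) hf'
  refine le_trans ?_ h2
  have h3 : (1 - e) * f / a ≥ 1 := by
    rw [ge_iff_le, one_le_div a0, ha]; gcongr
  have h4 : (1 - e) * f + (i + 1) * b ≤ ((1 - e) * f + b) * (1 + i * (b / a)) := by
    have : ((1 - e) * f + b) * (1 + i * (b / a)) = (1 - e) * f + b + i * b * ((1 - e) * f / a)
      + b * (i * (b / a)) := by field_simp; ring
    rw [this]
    have h5 : i * b * 1 ≤ i * b * ((1 - e) * f / a) := by gcongr
    have h6 : 0 ≤ b * (i * (b / a)) := by positivity
    linarith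
  calc _ = a ^ i * ((1 - e) * f + (i + 1) * b) := by rw [ha, mul_pow]; ring
    _ ≤ a ^ i * (((1 - e) * f + b) * (1 + i * (b / a))) := by gcongr
    _ = _ := by ring

lemma phi_meas (hK : IsCompact K) : Measurable fun x => vrad (secA K x) := by
  unfold vrad
  have : Measurable fun x => volume (secA K x) := by
    simp_rw [secA_eq]
    exact measurable_measure_prodMk_left (hK.image continuous_fst).measurableSet
  exact this.ennreal_toReal.pow_const _

lemma phi_concave (hi : 1 ≤ i) (hK : IsCompact K) (hc : Convex ℝ K) {x x0 : Fin m → ℝ} {a b : ℝ}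
    (ha : 0 < a) (hb : 0 < b) (hab : a + b = 1) (hx : (secA K x).Nonempty)
    (hx0 : (secA K x0).Nonempty) :
    a * vrad (secA K x) + b * vrad (secA K x0) ≤ vrad (secA K (a • x + b • x0)) :=
  bm_add hi (secA_closed hK _).measurableSet (secA_closed hK _).measurableSet
    (secA_closed hK _).measurableSet (secA_bdd hK _) (secA_bdd hK _) (secA_bdd hK _) hx hx0 ha hb
    (secA_comb hc ha.le hb.le hab)

lemma phi_bdd (hK : IsCompact K) (x : Fin m → ℝ) :
    vrad (secA K x) ≤ vrad ((fun p => p.1.2) '' K) :=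
  vrad_mono (secA_sub x) (hK.image (by fun_prop)).isBounded

lemma core_eps (hi : 1 ≤ i) (hK : IsCompact K) (hc : Convex ℝ K) {x0 : Fin m → ℝ}
    (hx0 : (secA K x0).Nonempty) {e : ℝ} (he0 : 0 < e) (he1 : e < 1) :
    ENNReal.ofReal ((1 - e) ^ (m + l)) *
      (ENNReal.ofReal ((1 - e) ^ (i + 1)) * (∫⁻ p in K, ENNReal.ofReal (vrad (secA K p.1.1))) +
      ENNReal.ofReal ((1 - e) ^ i * (i + 1) * e * vrad (secA K x0)) * volume K)
      ≤ ∫⁻ p in K, ENNReal.ofReal (vrad (secA K p.1.1)) := by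
  have h1e : 0 < 1 - e := by linarith
  have mphi : Measurable fun x => ENNReal.ofReal (vrad (secA K x)) := (phi_meas hK).ennreal_ofReal
  have eN : volume K = ∫⁻ x, ∫⁻ s in Set.Ioi (0:ℝ), volume (secD K x s) := by
    have := core_layer hK (F := fun _ => 1) measurable_const
    simpa using this
  have mD : Measurable fun q : (Fin m → ℝ) × ℝ => volume (secD K q.1 q.2) := by
    have : MeasurableSet {r : ((Fin m → ℝ) × ℝ) × (Fin i → ℝ) | r.1.2 < gfun K (r.1.1, r.2)} :=
      measurableSet_lt (by fun_prop) ((gfun_meas hK).comp (by fun_prop))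
    exact measurable_measure_prodMk_left this
  have mDx : ∀ x, Measurable fun s => volume (secD K x s) := fun x =>
    mD.comp measurable_prodMk_left
  have mI : Measurable fun x => ∫⁻ s in Set.Ioi (0:ℝ), volume (secD K x s) :=
    Measurable.lintegral_prod_right' (f := fun q : (Fin m → ℝ) × ℝ => volume (secD K q.1 q.2)) mD
  rw [core_layer hK mphi, eN]
  have erhs : ∫⁻ x, ∫⁻ s in Set.Ioi (0:ℝ), ENNReal.ofReal (vrad (secA K x)) * volume (secD K x s)
      = ENNReal.ofReal ((1 - e) ^ (m + l)) * ∫⁻ x, ∫⁻ s in Set.Ioi (0:ℝ),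
        ENNReal.ofReal (vrad (secA K ((1 - e) • x + e • x0))) *
          volume (secD K ((1 - e) • x + e • x0) ((1 - e) ^ l * s)) := by
    rw [lint_scale volume h1e (e • x0)]
    simp_rw [fun y => lint_scale_Ioi (c := (1 - e) ^ l) (by positivity)
      (fun s => ENNReal.ofReal (vrad (secA K y)) * volume (secD K y s))]
    rw [lintegral_const_mul' _ _ (by simp), ← mul_assoc, ← ENNReal.ofReal_mul (by positivity),
      Module.finrank_fin_fun, ← pow_add]
  conv_rhs => rw [erhs]
  refine mul_le_mul' le_rfl ?_
  have mI2 : Measurable fun x => ∫⁻ s in Set.Ioi (0:ℝ),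
      ENNReal.ofReal (vrad (secA K x)) * volume (secD K x s) :=
    Measurable.lintegral_prod_right' (f := fun q : (Fin m → ℝ) × ℝ =>
      ENNReal.ofReal (vrad (secA K q.1)) * volume (secD K q.1 q.2))
      ((mphi.comp measurable_fst).mul mD)
  rw [← lintegral_const_mul _ mI2, ← lintegral_const_mul _ mI,
    ← lintegral_add_left (mI2.const_mul _)]
  refine lintegral_mono fun x => ?_
  rw [← lintegral_const_mul _ ((mDx x).const_mul _), ← lintegral_const_mul _ (mDx x),
    ← lintegral_add_left (((mDx x).const_mul _).const_mul _)]
  refine setLIntegral_mono' measurableSet_Ioi fun s hs => ?_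
  have hs0 : (0:ℝ) < s := hs
  have hs' : 0 < (1 - e) ^ l * s := by positivity
  by_cases h0 : volume (secD K x s) = 0
  · simp [h0]
  have hne : (secD K x s).Nonempty := nonempty_of_measure_ne_zero h0
  have hneA : (secA K x).Nonempty := hne.mono (secD_sub hs0.le)
  have ev : ∀ y t, 0 < t → volume (secD K y t) = ENNReal.ofReal (vrad (secD K y t) ^ i) := by
    intro y t ht
    rw [vrad_pow hi, ENNReal.ofReal_toReal (secD_bdd hK ht.le).measure_lt_top.ne]
  have hpos : 0 < vrad (secD K x s) := by
    unfold vrad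
    exact Real.rpow_pos_of_pos
      (ENNReal.toReal_pos h0 (secD_bdd hK hs0.le).measure_lt_top.ne) _
  have b1 := phi_concave hi hK hc h1e he0 (by ring) hneA hx0
  have b2 : (1 - e) * vrad (secD K x s) + e * vrad (secA K x0) ≤
      vrad (secD K ((1 - e) • x + e • x0) ((1 - e) ^ l * s)) :=
    bm_add hi (secD_meas hK _ _) (secA_closed hK _).measurableSet
      (secD_meas hK _ _) (secD_bdd hK hs0.le) (secA_bdd hK _) (secD_bdd hK hs'.le) hne hx0 h1e he0
      (secD_comb hK hc h1e he0.le (by ring))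
  have := pointwise_ineq hi he0 he1 (vrad_nonneg _) hpos
    (vrad_mono (secD_sub hs0.le) (secA_bdd hK x)) b1 b2
  rw [ev x s hs0, ev _ _ hs', ← ENNReal.ofReal_mul (vrad_nonneg _),
    ← ENNReal.ofReal_mul (by positivity), ← ENNReal.ofReal_mul (by
      have := vrad_nonneg (secA K x0); positivity), ← ENNReal.ofReal_mul (vrad_nonneg _),
    ← ENNReal.ofReal_add]
  · exact ENNReal.ofReal_le_ofReal this
  · have := vrad_nonneg (secA K x); positivity
  · have := vrad_nonneg (secA K x0); positivity

lemma core_avg (hi : 1 ≤ i) (hK : IsCompact K) (hc : Convex ℝ K) {x0 : Fin m → ℝ}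
    (hx0 : (secA K x0).Nonempty) :
    ((i : ℝ) + 1) * vrad (secA K x0) * (volume K).toReal ≤
      ((m + i + l : ℕ) + 1 : ℝ) * (∫⁻ p in K, ENNReal.ofReal (vrad (secA K p.1.1))).toReal := by
  set J := ∫⁻ p in K, ENNReal.ofReal (vrad (secA K p.1.1)) with hJ
  have hKf : volume K ≠ ⊤ := hK.measure_lt_top.ne
  have Jf : J ≠ ⊤ := by
    have : J ≤ ∫⁻ p in K, ENNReal.ofReal (vrad ((fun p => p.1.2) '' K)) :=
      lintegral_mono fun p => ENNReal.ofReal_le_ofReal (phi_bdd hK _)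
    refine ne_top_of_le_ne_top ?_ this
    rw [setLIntegral_const]
    exact ENNReal.mul_ne_top (by simp) hKf
  set j := J.toReal
  set N := (volume K).toReal
  set M := vrad (secA K x0) with hM
  have M0 : 0 ≤ M := vrad_nonneg _
  have j0 : 0 ≤ j := ENNReal.toReal_nonneg
  have N0 : 0 ≤ N := ENNReal.toReal_nonneg
  set n := m + i + l with hn
  have key : ∀ e : ℝ, 0 < e → e < 1 → (1 - e) ^ n * ((i + 1) * M * N) ≤ (n + 1) * j := by
    intro e he0 he1
    have h1e : 0 < 1 - e := by linarith
    have h := ENNReal.toReal_mono Jf (core_eps hi hK hc hx0 he0 he1)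
    rw [ENNReal.toReal_mul, ENNReal.toReal_add (ENNReal.mul_ne_top (by simp) Jf)
      (ENNReal.mul_ne_top (by simp) hKf), ENNReal.toReal_mul, ENNReal.toReal_mul,
      ENNReal.toReal_ofReal (by positivity), ENNReal.toReal_ofReal (by positivity),
      ENNReal.toReal_ofReal (by positivity)] at h
    change (1 - e) ^ (m + l) * ((1 - e) ^ (i + 1) * j + (1 - e) ^ i * (i + 1) * e * M * N) ≤ j at h
    have h2 : (1 - e) ^ (n + 1) * j + (1 - e) ^ n * (i + 1) * e * M * N ≤ j := by
      calc _ = (1 - e) ^ (m + l) * ((1 - e) ^ (i + 1) * j + (1 - e) ^ i * (i + 1) * e * M * N) := by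
            rw [hn]; ring
        _ ≤ j := h
    have h3 : 1 + ((n + 1 : ℕ) : ℝ) * (-e) ≤ (1 + (-e)) ^ (n + 1) :=
      one_add_mul_le_pow (by linarith) _
    have h4 : (1 + ((n + 1 : ℕ) : ℝ) * (-e)) * j ≤ (1 - e) ^ (n + 1) * j := by
      rw [← sub_eq_add_neg] at h3; gcongr
    push_cast at h4
    have h5 : e * ((1 - e) ^ n * ((i + 1) * M * N)) ≤ e * ((n + 1) * j) := by linarith
    exact le_of_mul_le_mul_left h5 he0
  have lim : Filter.Tendsto (fun e : ℝ => (1 - e) ^ n * ((i + 1) * M * N)) (nhdsWithin 0 (Set.Ioi 0))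
      (nhds ((1 - 0) ^ n * ((i + 1) * M * N))) := by
    apply Filter.Tendsto.mono_left _ nhdsWithin_le_nhds
    exact Continuous.tendsto (by fun_prop) 0
  have := le_of_tendsto lim (b := ((n : ℝ) + 1) * j) (by
    filter_upwards [Ioo_mem_nhdsGT (zero_lt_one' ℝ)] with e he
    exact key e he.1 he.2)
  simpa using this

lemma phi_usc (hi : 1 ≤ i) (hK : IsCompact K) :
    UpperSemicontinuous fun x => vrad (secA K x) := by
  intro x c hxc
  have hc0 : 0 < c := (vrad_nonneg _).trans_lt hxc
  have h1 : volume (secA K x) < ENNReal.ofReal (c ^ i) := by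
    rw [← ENNReal.ofReal_toReal (secA_bdd hK x).measure_lt_top.ne, ← vrad_pow hi]
    exact (ENNReal.ofReal_lt_ofReal_iff (by positivity)).2
      (pow_lt_pow_left₀ hxc (vrad_nonneg _) (by omega))
  obtain ⟨U, hU, hUo, hUv⟩ := Set.exists_isOpen_lt_of_lt _ _ h1
  have hcomp : IsCompact (Prod.fst '' (Prod.fst '' K ∩ {q : (Fin m → ℝ) × (Fin i → ℝ) | q.2 ∉ U})) := by
    refine IsCompact.image ?_ continuous_fst
    refine (hK.image continuous_fst).inter_right ?_
    exact (hUo.isClosed_compl).preimage continuous_snd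
  have hmem : (Prod.fst '' (Prod.fst '' K ∩ {q : (Fin m → ℝ) × (Fin i → ℝ) | q.2 ∉ U}))ᶜ ∈ nhds x := by
    refine hcomp.isClosed.isOpen_compl.mem_nhds ?_
    rintro ⟨q, ⟨hq1, hq2⟩, rfl⟩
    refine hq2 (hU ?_)
    rw [secA_eq]
    exact hq1
  filter_upwards [hmem] with x' hx'
  have hsub : secA K x' ⊆ U := by
    intro y hy
    by_contra hyU
    refine hx' ⟨(x', y), ⟨?_, hyU⟩, rfl⟩
    rw [secA_eq] at hy
    exact hy
  have h2 : (volume (secA K x')).toReal < c ^ i := by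
    have := (measure_mono hsub).trans_lt hUv
    rw [← ENNReal.toReal_ofReal (pow_nonneg hc0.le i)]
    exact (ENNReal.toReal_lt_toReal (secA_bdd hK x').measure_lt_top.ne (by simp)).2 this
  rw [← vrad_pow hi] at h2
  exact lt_of_pow_lt_pow_left₀ _ hc0.le h2

lemma core_jensen (hi : 1 ≤ i) (hK : IsCompact K) (hc : Convex ℝ K) (hvol : volume K ≠ 0)
    (hcen : ∫ p in K, p.1.1 = 0) :
    (∫⁻ p in K, ENNReal.ofReal (vrad (secA K p.1.1))).toReal ≤
      vrad (secA K 0) * (volume K).toReal := by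
  set φ : (Fin m → ℝ) → ℝ := fun x => vrad (secA K x) with hφ
  set P : Set (Fin m → ℝ) := (fun p => p.1.1) '' K with hP
  have hPc : IsCompact P := hK.image (by fun_prop)
  have hPne : ∀ x ∈ P, (secA K x).Nonempty := by
    rintro _ ⟨p, hp, rfl⟩
    exact ⟨p.1.2, p.2, hp⟩
  have hHclosed : IsClosed {q : (Fin m → ℝ) × ℝ | q.1 ∈ P ∧ q.2 ≤ φ q.1} :=
    (upperSemicontinuousOn_iff_isClosed_hypograph hPc.isClosed).1
      ((phi_usc hi hK).upperSemicontinuousOn P)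
  have hPconv : Convex ℝ P := by
    have := hc.linear_image ((LinearMap.fst ℝ (Fin m → ℝ) (Fin i → ℝ)) ∘ₗ
      (LinearMap.fst ℝ _ (Fin l → ℝ)))
    exact this
  have hconc : ConcaveOn ℝ P φ := by
    refine concaveOn_iff_forall_pos.2 ⟨hPconv, ?_⟩
    intro x hx y hy a b ha hb hab
    exact phi_concave hi hK hc ha hb hab (hPne x hx) (hPne y hy)
  have hHconv := hconc.convex_hypograph
  have hKf : volume K ≠ ⊤ := hK.measure_lt_top.ne
  have int1 : IntegrableOn (fun p : ((Fin m → ℝ) × (Fin i → ℝ)) × (Fin l → ℝ) => p.1.1) K :=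
    (by fun_prop : Continuous _).continuousOn.integrableOn_compact hK
  have mφ : Measurable fun p : ((Fin m → ℝ) × (Fin i → ℝ)) × (Fin l → ℝ) => φ p.1.1 :=
    (phi_meas hK).comp (by fun_prop)
  have int2 : IntegrableOn (fun p : ((Fin m → ℝ) × (Fin i → ℝ)) × (Fin l → ℝ) => φ p.1.1) K := by
    refine Measure.integrableOn_of_bounded (M := vrad ((fun p => p.1.2) '' K)) hKf
      mφ.aestronglyMeasurable ?_
    refine Filter.Eventually.of_forall fun p => ?_
    rw [Real.norm_of_nonneg (vrad_nonneg _)]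
    exact phi_bdd hK _
  have hav := Convex.set_average_mem (μ := volume) (t := K)
    (f := fun p => (p.1.1, φ p.1.1)) hHconv hHclosed hvol hKf
    (by
      filter_upwards [ae_restrict_mem hK.measurableSet] with p hp
      exact ⟨⟨p, hp, rfl⟩, le_rfl⟩) (int1.prodMk int2)
  rw [setAverage_eq, integral_pair int1 int2, hcen] at hav
  have h2 := hav.2
  simp only [Prod.smul_mk, smul_zero, smul_eq_mul] at h2
  have e : ∫ p in K, φ p.1.1 = (∫⁻ p in K, ENNReal.ofReal (φ p.1.1)).toReal :=
    integral_eq_lintegral_of_nonneg_ae (Filter.Eventually.of_forall fun p => vrad_nonneg _)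
      mφ.aestronglyMeasurable
  rw [e, inv_mul_eq_div, measureReal_def, div_le_iff₀ (ENNReal.toReal_pos hvol hKf)] at h2
  exact h2

theorem core_main (hi : 1 ≤ i) (hK : IsCompact K) (hc : Convex ℝ K) (hvol : volume K ≠ 0)
    (hcen : ∫ p in K, p.1.1 = 0) {x0 : Fin m → ℝ} (hx0 : (secA K x0).Nonempty) :
    (((i : ℝ) + 1) / ((m + i + l : ℕ) + 1)) ^ i * (volume (secA K x0)).toReal ≤
      (volume (secA K 0)).toReal := by
  have h1 := core_avg hi hK hc hx0
  have h2 := core_jensen hi hK hc hvol hcen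
  have hN : 0 < (volume K).toReal := ENNReal.toReal_pos hvol hK.measure_lt_top.ne
  rw [← vrad_pow hi, ← vrad_pow hi, ← mul_pow]
  have h3 := vrad_nonneg (secA K x0)
  refine pow_le_pow_left₀ (by positivity) ?_ _
  rw [div_mul_eq_mul_div, div_le_iff₀ (by positivity)]
  refine le_of_mul_le_mul_right ?_ hN
  calc _ ≤ _ := h1
    _ ≤ ((m + i + l : ℕ) + 1 : ℝ) * (vrad (secA K 0) * (volume K).toReal) := by gcongr
    _ = _ := by ring

end core

lemma proj_coords {V : Type*} [NormedAddCommGroup V] [NormedSpace ℝ V] [FiniteDimensional ℝ V]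
    {n k i : ℕ} (hik : i ≤ k) (hkn : k < n) (hV : Module.finrank ℝ V = n)
    (E : Submodule ℝ V) (hE : Module.finrank ℝ E = k) (S : V →ₗ[ℝ] (Fin i → ℝ))
    (hS : E.map S = ⊤) :
    ∃ (q : V →ₗ[ℝ] (Fin (n - k) → ℝ))
      (Φ : V ≃ₗ[ℝ] ((Fin (n - k) → ℝ) × (Fin i → ℝ)) × (Fin (k - i) → ℝ)),
      q.ker = E ∧ (∀ v, (Φ v).1 = (q v, S v)) := by
  have hquot : Module.finrank ℝ (V ⧸ E) = Module.finrank ℝ (Fin (n - k) → ℝ) := by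
    have := E.finrank_quotient_add_finrank
    rw [Module.finrank_fin_fun]; omega
  let eq := LinearEquiv.ofFinrankEq _ _ hquot
  let q : V →ₗ[ℝ] (Fin (n - k) → ℝ) := eq.toLinearMap ∘ₗ E.mkQ
  have hqk : q.ker = E := by
    simp [q, LinearMap.ker_comp]
  have hqs : Function.Surjective q := eq.surjective.comp E.mkQ_surjective
  have hpr : (q.prod S).range = ⊤ := by
    rw [LinearMap.range_eq_top]
    rintro ⟨x, y⟩
    obtain ⟨v, rfl⟩ := hqs x
    have : y - S v ∈ E.map S := by rw [hS]; trivial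
    obtain ⟨w, hw, hwy⟩ := this
    refine ⟨v + w, ?_⟩
    have hw0 : q w = 0 := by rw [← LinearMap.mem_ker, hqk]; exact hw
    simp [hw0, hwy]
  have hker : Module.finrank ℝ (q.prod S).ker = Module.finrank ℝ (Fin (k - i) → ℝ) := by
    have := (q.prod S).finrank_range_add_finrank_ker
    rw [hpr, finrank_top, Module.finrank_prod, Module.finrank_fin_fun, Module.finrank_fin_fun] at this
    rw [Module.finrank_fin_fun]; omega
  obtain ⟨N', hN'⟩ := (q.prod S).ker.exists_isCompl
  let er := LinearEquiv.ofFinrankEq _ _ hker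
  let r : V →ₗ[ℝ] (Fin (k - i) → ℝ) := er.toLinearMap ∘ₗ Submodule.projectionOnto _ _ hN'
  have hrk : r.ker = N' := by
    simp [r, LinearMap.ker_comp]
  have hrr : r.range = ⊤ := by
    rw [LinearMap.range_eq_top]
    exact er.surjective.comp (LinearMap.range_eq_top.1 (Submodule.range_projectionOnto hN'))
  refine ⟨q, LinearMap.equivProdOfSurjectiveOfIsCompl (q.prod S) r hpr hrr (by rw [hrk]; exact hN'),
    hqk, fun v => ?_⟩
  simp

theorem proj_ineq {n k i : ℕ} (hi : 1 ≤ i) (hik : i ≤ k) (hkn : k < n)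
    {K : Set (EuclideanSpace ℝ (Fin n))}
    (hKconv : Convex ℝ K) (hKcomp : IsCompact K) (hKint : (interior K).Nonempty)
    (hcentroid : (∫ x in K, x) = 0)
    (E : Submodule ℝ (EuclideanSpace ℝ (Fin n))) (hE : Module.finrank ℝ E = k)
    {x : EuclideanSpace ℝ (Fin n)} (hx : x ∈ K) (S : EuclideanSpace ℝ (Fin n) →ₗ[ℝ] (Fin i → ℝ)) :
    (((i : ℝ) + 1) / ((n : ℝ) + 1)) ^ i *
      (volume (S '' ((fun y => y - x) '' K ∩ (E : Set _)))).toReal ≤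
    (volume (S '' (K ∩ (E : Set _)))).toReal := by
  by_cases hS : E.map S = ⊤
  swap
  · have h0 : volume (S '' ((fun y => y - x) '' K ∩ (E : Set _))) = 0 := by
      refine measure_mono_null ?_ (Measure.addHaar_submodule volume _ hS)
      rintro _ ⟨v, ⟨_, hv⟩, rfl⟩
      exact ⟨v, hv, rfl⟩
    rw [h0]; simp
  obtain ⟨q, Φ, hq, hΦ⟩ := proj_coords hik hkn (by simp) E hE S hS
  let Φc := Φ.toContinuousLinearEquiv
  have hΦc : ∀ v, Φc v = Φ v := fun v => rfl
  set K' := Φc '' K with hK'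
  have cK' : IsCompact K' := hKcomp.image Φc.continuous
  have vK' : Convex ℝ K' := hKconv.linear_image Φ.toLinearMap
  have nK' : volume K' ≠ 0 := by
    have hop : IsOpen (Φc '' interior K) := Φc.toHomeomorph.isOpenMap _ isOpen_interior
    have := hop.measure_pos volume (hKint.image _)
    exact (this.trans_le (measure_mono (Set.image_mono interior_subset))).ne'
  have hcen : ∫ p in K', p.1.1 = 0 := by
    have i1 : (volume : Measure ((Fin (n - k) → ℝ) × (Fin i → ℝ))).IsAddHaarMeasure :=
      Measure.prod.instIsAddHaarMeasure _ _
    have i2 : (volume : Measure (((Fin (n - k) → ℝ) × (Fin i → ℝ)) ×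
        (Fin (k - i) → ℝ))).IsAddHaarMeasure :=
      Measure.prod.instIsAddHaarMeasure _ _
    have i3 : (Measure.map Φc volume).IsAddHaarMeasure :=
      Φc.isAddHaarMeasure_map volume
    have e1 := Measure.isAddLeftInvariant_eq_smul
      (volume : Measure (((Fin (n - k) → ℝ) × (Fin i → ℝ)) × (Fin (k - i) → ℝ)))
      (Measure.map Φc volume)
    rw [e1, Measure.restrict_smul, integral_smul_nnreal_measure]
    have emb : MeasurableEmbedding Φc := Φc.toHomeomorph.measurableEmbedding
    rw [emb.setIntegral_map, hK', Set.preimage_image_eq _ Φc.injective]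
    have e2 : ∀ v, (Φc v).1.1 = q v := by intro v; rw [hΦc, hΦ]
    simp_rw [e2]
    have e3 := (LinearMap.toContinuousLinearMap q).integral_comp_comm
      (μ := volume.restrict K) (φ := fun x => x)
      (continuous_id.continuousOn.integrableOn_compact hKcomp)
    have e4 : ∫ v in K, q v = 0 := by
      refine e3.trans ?_
      rw [hcentroid]; simp
    rw [e4, smul_zero]
  have hmem : ∀ u y, y ∈ secA K' u ↔ ∃ v ∈ K, q v = u ∧ S v = y := by
    intro u y
    constructor
    · rintro ⟨z, v, hv, hvz⟩
      have h1 := hΦ v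
      rw [← hΦc, hvz] at h1
      simp only [Prod.mk.injEq] at h1
      exact ⟨v, hv, h1.1.symm, h1.2.symm⟩
    · rintro ⟨v, hv, rfl, rfl⟩
      refine ⟨(Φ v).2, v, hv, ?_⟩
      rw [hΦc, ← hΦ]
  have hqE : ∀ v, q v = 0 ↔ v ∈ E := by intro v; rw [← LinearMap.mem_ker, hq]
  have s0 : secA K' 0 = S '' (K ∩ (E : Set _)) := by
    ext y
    rw [hmem]
    constructor
    · rintro ⟨v, hv, h1, h2⟩
      exact ⟨v, ⟨hv, (hqE v).1 h1⟩, h2⟩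
    · rintro ⟨v, ⟨hv, h1⟩, h2⟩
      exact ⟨v, hv, (hqE v).2 h1, h2⟩
  have sx : secA K' (q x) = (fun y => y + S x) '' (S '' ((fun y => y - x) '' K ∩ (E : Set _))) := by
    ext y
    rw [hmem]
    constructor
    · rintro ⟨v, hv, h1, h2⟩
      refine ⟨S (v - x), ⟨v - x, ⟨⟨v, hv, rfl⟩, ?_⟩, rfl⟩, ?_⟩
      · exact (hqE _).1 (by rw [map_sub, h1, sub_self])
      · simp [h2]
    · rintro ⟨_, ⟨_, ⟨⟨v, hv, rfl⟩, hE'⟩, rfl⟩, rfl⟩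
      refine ⟨v, hv, ?_, by simp⟩
      have := (hqE _).2 hE'
      rw [map_sub, sub_eq_zero] at this
      exact this
  have hne : (secA K' (q x)).Nonempty := ⟨S x, (hmem _ _).2 ⟨x, hx, rfl, rfl⟩⟩
  have main := core_main hi cK' vK' nK' hcen hne
  rw [s0, sx, Set.image_add_right, measure_preimage_add_right] at main
  have : n - k + i + (k - i) = n := by omega
  rw [this] at main
  exact main

lemma seg_one {A : Set ℝ} (hA : IsCompact A) (hc : Convex ℝ A) (hne : A.Nonempty) {s : ℝ}
    (hs : 0 ≤ s) : volume (A + Set.Icc 0 s) = volume A + ENNReal.ofReal s := by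
  have hcon : IsConnected A := ⟨hne, hc.isPreconnected⟩
  have e := eq_Icc_of_connected_compact hcon hA
  have hle : sInf A ≤ sSup A := by
    rw [← Set.nonempty_Icc, ← e]; exact hne
  rw [e, Set.Icc_add_Icc hle hs, Real.volume_Icc, Real.volume_Icc,
    ← ENNReal.ofReal_add (by linarith) hs]
  congr 1; ring

lemma seg_prod {d : ℕ} {L : Set ((Fin d → ℝ) × ℝ)} (hL : IsCompact L) (hc : Convex ℝ L) {s : ℝ}
    (hs : 0 ≤ s) : volume (L + segment ℝ 0 (0, s)) =
      volume L + ENNReal.ofReal s * volume (Prod.fst '' L) := by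
  have cseg : IsCompact (segment ℝ (0 : (Fin d → ℝ) × ℝ) (0, s)) := by
    rw [segment_eq_image_lineMap]
    exact isCompact_Icc.image (by fun_prop)
  have mseg : ∀ p : (Fin d → ℝ) × ℝ, p ∈ segment ℝ (0 : (Fin d → ℝ) × ℝ) (0, s) ↔
      p.1 = 0 ∧ p.2 ∈ Set.Icc 0 s := by
    rintro ⟨p, r⟩
    rw [segment_eq_image]
    constructor
    · rintro ⟨t, ⟨h0, h1⟩, h⟩
      simp only [smul_zero, Prod.smul_mk, zero_add, Prod.mk.injEq] at h
      obtain ⟨rfl, rfl⟩ := h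
      refine ⟨rfl, ?_, ?_⟩
      · simp; positivity
      · simp; nlinarith
    · rintro ⟨h1, h2, h3⟩
      simp only at h1 h2 h3
      subst h1
      rcases hs.eq_or_lt with rfl | hs'
      · refine ⟨0, by simp, ?_⟩
        have : r = 0 := le_antisymm h3 h2
        simp [this]
        rfl
      · refine ⟨r / s, ⟨by positivity, by rw [div_le_one hs']; exact h3⟩, ?_⟩
        simp [hs'.ne']
  have cfib : ∀ y, IsCompact (Prod.mk y ⁻¹' L) := fun y => by
    have : Prod.mk y ⁻¹' L = Prod.snd '' (L ∩ Prod.fst ⁻¹' {y}) := by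
      ext r; simp
    rw [this]
    exact (hL.inter_right (isClosed_singleton.preimage continuous_fst)).image continuous_snd
  have vfib : ∀ y, Convex ℝ (Prod.mk y ⁻¹' L) := by
    intro y a ha b hb p q hp hq hpq
    have := hc ha hb hp hq hpq
    simp only [Prod.smul_mk, Prod.mk_add_mk] at this
    rw [← add_smul, hpq, one_smul] at this
    exact this
  have hfib : ∀ y, Prod.mk y ⁻¹' (L + segment ℝ 0 (0, s)) = Prod.mk y ⁻¹' L + Set.Icc 0 s := by
    intro y
    ext r
    constructor
    · rintro ⟨⟨a, b⟩, hab, q, hq, h⟩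
      obtain ⟨h1, h2⟩ := (mseg q).1 hq
      obtain ⟨q1, q2⟩ := q
      simp only [Prod.mk_add_mk, Prod.mk.injEq] at h h1 h2
      subst h1
      obtain ⟨h3, h4⟩ := h
      rw [add_zero] at h3
      subst h3
      exact ⟨b, hab, q2, h2, h4⟩
    · rintro ⟨b, hb, q, hq, rfl⟩
      exact ⟨(y, b), hb, (0, q), (mseg _).2 ⟨rfl, hq⟩, by simp⟩
  have mL : MeasurableSet L := hL.measurableSet
  have mF : MeasurableSet (Prod.fst '' L) := (hL.image continuous_fst).measurableSet
  rw [Measure.volume_eq_prod, Measure.prod_apply (hL.add cseg).measurableSet,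
    Measure.prod_apply mL]
  have : ∀ y, volume (Prod.mk y ⁻¹' (L + segment ℝ 0 (0, s))) =
      volume (Prod.mk y ⁻¹' L) + (Prod.fst '' L).indicator (fun _ => ENNReal.ofReal s) y := by
    intro y
    rw [hfib]
    by_cases hy : (Prod.mk y ⁻¹' L).Nonempty
    · rw [seg_one (cfib y) (vfib y) hy hs, Set.indicator_of_mem]
      obtain ⟨r, hr⟩ := hy
      exact ⟨_, hr, rfl⟩
    · rw [Set.not_nonempty_iff_eq_empty] at hy
      rw [Set.indicator_of_notMem, hy]
      · simp
      · rintro ⟨⟨a, b⟩, hab, rfl⟩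
        have : b ∈ Prod.mk a ⁻¹' L := hab
        simp only at hy
        rw [hy] at this
        exact this
  simp_rw [this]
  rw [lintegral_add_left (measurable_measure_prodMk_left mL), lintegral_indicator mF,
    setLIntegral_const]

lemma seg_lemma {d : ℕ} (v : Fin (d + 1) → ℝ) :
    ∃ (S : (Fin (d + 1) → ℝ) →ₗ[ℝ] (Fin d → ℝ)) (c : ℝ), 0 ≤ c ∧
      ∀ L : Set (Fin (d + 1) → ℝ), IsCompact L → Convex ℝ L → ∀ s : ℝ, 0 ≤ s →
        (volume (L + segment ℝ 0 (s • v))).toReal =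
          (volume L).toReal + s * c * (volume (S '' L)).toReal := by
  by_cases hv : v = 0
  · refine ⟨0, 0, le_rfl, fun L _ _ s _ => ?_⟩
    subst hv
    simp
  let Ψ : (Fin (d + 1) → ℝ) ≃L[ℝ] (Fin d → ℝ) × ℝ :=
    ContinuousLinearEquiv.ofFinrankEq (by simp)
  have h1 : Ψ v ≠ 0 := by simpa using hv
  have h2 : ((0, 1) : (Fin d → ℝ) × ℝ) ≠ 0 := by simp
  obtain ⟨A, hA⟩ := SeparatingDual.exists_continuousLinearEquiv_apply_eq (R := ℝ) h1 h2
  let Φ := Ψ.trans A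
  have hΦ : Φ v = (0, 1) := hA
  have i1 : (volume : Measure ((Fin d → ℝ) × ℝ)).IsAddHaarMeasure :=
      Measure.prod.instIsAddHaarMeasure _ _
  have i2 : (Measure.map Φ.symm volume).IsAddHaarMeasure := Φ.symm.isAddHaarMeasure_map volume
  have e1 := Measure.isAddLeftInvariant_eq_smul (volume : Measure (Fin (d + 1) → ℝ))
    (Measure.map Φ.symm volume)
  set c := Measure.addHaarScalarFactor (volume : Measure (Fin (d + 1) → ℝ))
    (Measure.map Φ.symm volume) with hc
  have key : ∀ M : Set (Fin (d + 1) → ℝ), (volume M).toReal = c * (volume (Φ '' M)).toReal := by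
    intro M
    have emb : MeasurableEmbedding Φ.symm := Φ.symm.toHomeomorph.measurableEmbedding
    conv_lhs => rw [e1]
    rw [Measure.smul_apply, emb.map_apply, ← Φ.image_eq_preimage_symm]
    simp [ENNReal.smul_def]
  refine ⟨LinearMap.fst ℝ _ _ ∘ₗ Φ.toLinearEquiv.toLinearMap, c, c.2, fun L hL vL s hs => ?_⟩
  have cL : IsCompact (Φ '' L) := hL.image Φ.continuous
  have vL' : Convex ℝ (Φ '' L) := vL.linear_image Φ.toLinearEquiv.toLinearMap
  have e2 : Φ '' (L + segment ℝ 0 (s • v)) = Φ '' L + segment ℝ 0 (0, s) := by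
    have := Set.image_add Φ (s := L) (t := segment ℝ 0 (s • v))
    rw [this]
    congr 1
    have := image_segment ℝ Φ.toLinearEquiv.toLinearMap.toAffineMap 0 (s • v)
    refine this.trans ?_
    simp [hΦ]
  have e3 : (LinearMap.fst ℝ _ _ ∘ₗ Φ.toLinearEquiv.toLinearMap) '' L = Prod.fst '' (Φ '' L) := by
    rw [Set.image_image]; rfl
  rw [key, key, e2, e3, seg_prod cL vL' hs, ENNReal.toReal_add cL.measure_lt_top.ne
    (ENNReal.mul_ne_top ENNReal.ofReal_ne_top (cL.image continuous_fst).measure_lt_top.ne),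
    ENNReal.toReal_mul, ENNReal.toReal_ofReal hs]
  ring

/-- The zonotope spanned by a list of vectors. -/
def zon {V : Type*} [AddCommGroup V] [Module ℝ V] : List V → Set V
  | [] => {0}
  | w :: ws => zon ws + segment ℝ 0 w

section zonsec
variable {V : Type*} [NormedAddCommGroup V] [NormedSpace ℝ V]

lemma segment_compact (w : V) : IsCompact (segment ℝ 0 w) := by
  rw [segment_eq_image_lineMap]
  exact isCompact_Icc.image (by fun_prop)

lemma zon_compact (ws : List V) : IsCompact (zon ws) := by
  induction ws with
  | nil => exact isCompact_singleton
  | cons w ws ih => exact ih.add (segment_compact w)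

lemma zon_convex (ws : List V) : Convex ℝ (zon ws) := by
  induction ws with
  | nil => exact convex_singleton 0
  | cons w ws ih => exact ih.add (convex_segment 0 w)

lemma zon_step (L : Set V) (w : V) (ws : List V) (s : ℝ) :
    L + s • zon (w :: ws) = (L + s • zon ws) + segment ℝ 0 (s • w) := by
  have : s • segment ℝ 0 w = segment ℝ 0 (s • w) := by
    have := image_segment ℝ (s • LinearMap.id : V →ₗ[ℝ] V).toAffineMap 0 w
    simpa using this
  rw [zon, smul_add, this, add_assoc]

lemma zon_poly [FiniteDimensional ℝ V] {L1 L2 : Set V} (c1 : IsCompact L1) (v1 : Convex ℝ L1)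
    (c2 : IsCompact L2) (v2 : Convex ℝ L2) {i : ℕ} {θ : ℝ}
    (h : ∀ S : V →ₗ[ℝ] (Fin i → ℝ), θ * (volume (S '' L1)).toReal ≤ (volume (S '' L2)).toReal)
    (ws : List V) : ∀ (d : ℕ) (T : V →ₗ[ℝ] (Fin d → ℝ)), ∃ a b : Polynomial ℝ,
      (∀ s : ℝ, 0 ≤ s → (volume (T '' (L1 + s • zon ws))).toReal = a.eval s) ∧
      (∀ s : ℝ, 0 ≤ s → (volume (T '' (L2 + s • zon ws))).toReal = b.eval s) ∧
      a.natDegree ≤ d ∧ b.natDegree ≤ d ∧ (i ≤ d → θ * a.coeff (d - i) ≤ b.coeff (d - i)) := by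
  induction ws with
  | nil =>
    intro d T
    refine ⟨Polynomial.C (volume (T '' L1)).toReal, Polynomial.C (volume (T '' L2)).toReal,
      fun s _ => ?_, fun s _ => ?_, ?_, ?_, fun hid => ?_⟩
    · simp [zon]
    · simp [zon]
    · simp
    · simp
    · rcases hid.eq_or_lt with rfl | hlt
      · simpa using h T
      · have : d - i ≠ 0 := by omega
        simp [Polynomial.coeff_C, this]
  | cons w ws ih =>
    have hstep : ∀ (L : Set V) (d : ℕ) (T : V →ₗ[ℝ] (Fin d → ℝ)) (s : ℝ),
        T '' (L + s • zon (w :: ws)) = T '' (L + s • zon ws) + segment ℝ 0 (s • T w) := by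
      intro L d T s
      rw [zon_step, Set.image_add]
      congr 1
      have := image_segment ℝ T.toAffineMap 0 (s • w)
      simpa using this
    have hcomp : ∀ (L : Set V), IsCompact L → ∀ (d : ℕ) (T : V →ₗ[ℝ] (Fin d → ℝ)) (s : ℝ),
        IsCompact (T '' (L + s • zon ws)) := fun L hL d T s =>
      (hL.add ((zon_compact ws).smul s)).image T.continuous_of_finiteDimensional
    have hconv : ∀ (L : Set V), Convex ℝ L → ∀ (d : ℕ) (T : V →ₗ[ℝ] (Fin d → ℝ)) (s : ℝ),
        Convex ℝ (T '' (L + s • zon ws)) := fun L hL d T s =>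
      (hL.add ((zon_convex ws).smul s)).linear_image T
    intro d T
    cases d with
    | zero =>
      obtain ⟨a, b, ha, hb, h1, h2, h3⟩ := ih 0 T
      have hz : ∀ s : ℝ, s • T w = 0 := fun s => Subsingleton.elim _ _
      refine ⟨a, b, fun s hs => ?_, fun s hs => ?_, h1, h2, h3⟩
      · rw [hstep, hz, segment_same, Set.singleton_zero, add_zero, ha s hs]
      · rw [hstep, hz, segment_same, Set.singleton_zero, add_zero, hb s hs]
    | succ d =>
      obtain ⟨S, c, hc, hS⟩ := seg_lemma (T w)
      obtain ⟨a, b, ha, hb, h1, h2, h3⟩ := ih (d + 1) T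
      obtain ⟨a', b', ha', hb', h1', h2', h3'⟩ := ih d (S ∘ₗ T)
      have hdeg : ∀ p p' : Polynomial ℝ, p.natDegree ≤ d + 1 → p'.natDegree ≤ d →
          (p + Polynomial.X * (Polynomial.C c * p')).natDegree ≤ d + 1 := by
        intro p p' hp hp'
        refine Polynomial.natDegree_add_le_of_degree_le hp ?_
        refine Polynomial.natDegree_mul_le.trans ?_
        have := Polynomial.natDegree_C_mul_le c p'
        have := Polynomial.natDegree_X_le (R := ℝ)
        omega
      refine ⟨a + Polynomial.X * (Polynomial.C c * a'), b + Polynomial.X * (Polynomial.C c * b'),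
        fun s hs => ?_, fun s hs => ?_, hdeg _ _ h1 h1', hdeg _ _ h2 h2', fun hid => ?_⟩
      · rw [hstep, hS _ (hcomp _ c1 _ _ _) (hconv _ v1 _ _ _) s hs, ha s hs, Set.image_image]
        have := ha' s hs
        simp only [LinearMap.coe_comp, Function.comp_def] at this
        rw [this]
        simp; ring
      · rw [hstep, hS _ (hcomp _ c2 _ _ _) (hconv _ v2 _ _ _) s hs, hb s hs, Set.image_image]
        have := hb' s hs
        simp only [LinearMap.coe_comp, Function.comp_def] at this
        rw [this]
        simp; ring
      · rcases hid.eq_or_lt with rfl | hlt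
        · have := h3 le_rfl
          simpa using this
        · have e : d + 1 - i = (d - i) + 1 := by omega
          have q1 := h3 hid
          have q2 := h3' (by omega)
          rw [e] at q1 ⊢
          simp only [Polynomial.coeff_add, Polynomial.coeff_X_mul, Polynomial.coeff_C_mul]
          nlinarith [mul_le_mul_of_nonneg_left q2 hc]

end zonsec

/-- The support function of a zonotope. -/
noncomputable def zsup {n : ℕ} (ws : List (EuclideanSpace ℝ (Fin n)))
    (x : EuclideanSpace ℝ (Fin n)) : ℝ := (ws.map (fun w => max (inner ℝ x w) 0)).sum

lemma zsup_upper {n : ℕ} (ws : List (EuclideanSpace ℝ (Fin n))) (x : EuclideanSpace ℝ (Fin n)) :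
    ∀ z ∈ zon ws, inner ℝ x z ≤ zsup ws x := by
  induction ws with
  | nil =>
    intro z hz
    have : z = 0 := hz
    simp [this, zsup]
  | cons w ws ih =>
    rintro _ ⟨z, hz, y, hy, rfl⟩
    have h1 := ih z hz
    rw [segment_eq_image] at hy
    obtain ⟨t, ⟨h0, h1'⟩, rfl⟩ := hy
    have : zsup (w :: ws) x = max (inner ℝ x w) 0 + zsup ws x := by simp [zsup]
    rw [this]
    simp only [smul_zero, zero_add, inner_add_right, inner_smul_right]
    have h2 := le_max_left (inner ℝ x w) 0
    have h3 := le_max_right (inner ℝ x w) 0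
    nlinarith

lemma zsup_attained {n : ℕ} (ws : List (EuclideanSpace ℝ (Fin n)))
    (x : EuclideanSpace ℝ (Fin n)) : ∃ z ∈ zon ws, inner ℝ x z = zsup ws x := by
  induction ws with
  | nil => exact ⟨0, rfl, by simp [zsup]⟩
  | cons w ws ih =>
    obtain ⟨z, hz, h⟩ := ih
    have : zsup (w :: ws) x = max (inner ℝ x w) 0 + zsup ws x := by simp [zsup]
    rw [this]
    rcases le_total (inner ℝ x w) 0 with h0 | h0
    · refine ⟨z + 0, ⟨z, hz, 0, left_mem_segment ℝ 0 w, rfl⟩, ?_⟩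
      rw [max_eq_right h0]; simp [h]
    · refine ⟨z + w, ⟨z, hz, w, right_mem_segment ℝ 0 w, rfl⟩, ?_⟩
      rw [max_eq_left h0, inner_add_right, h]; ring

lemma zon_between {n : ℕ} {ws : List (EuclideanSpace ℝ (Fin n))} {δ : ℝ} (hδ : 0 ≤ δ)
    (h : ∀ x, |zsup ws x - ‖x‖| ≤ δ * ‖x‖) :
    Metric.closedBall 0 (1 - δ) ⊆ zon ws ∧ zon ws ⊆ Metric.closedBall 0 (1 + δ) := by
  constructor
  · intro y hy
    by_contra hyz
    obtain ⟨f, u, hf, hu⟩ := geometric_hahn_banach_closed_point (zon_convex ws)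
      (zon_compact ws).isClosed hyz
    set x := (InnerProductSpace.toDual ℝ _).symm f with hx
    have hfx : ∀ z, f z = inner ℝ x z := fun z => by
      rw [hx, InnerProductSpace.toDual_symm_apply]
    obtain ⟨z, hz, hzs⟩ := zsup_attained ws x
    have h1 := hf z hz
    rw [hfx, hzs] at h1
    rw [hfx] at hu
    have h2 := real_inner_le_norm x y
    have h3 := (abs_le.1 (h x)).1
    rw [mem_closedBall_zero_iff] at hy
    nlinarith [norm_nonneg x, mul_le_mul_of_nonneg_left hy (norm_nonneg x)]
  · intro z hz
    rw [mem_closedBall_zero_iff]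
    have h1 := zsup_upper ws z z hz
    rw [real_inner_self_eq_norm_sq] at h1
    have h3 := (abs_le.1 (h z)).2
    rcases (norm_nonneg z).eq_or_lt with h0 | h0
    · rw [← h0]; linarith
    · nlinarith

lemma integral_ball_max {n : ℕ} (hn : 0 < n) : ∃ c : ℝ, 0 < c ∧
    ∀ x : EuclideanSpace ℝ (Fin n),
      ∫ u in Metric.closedBall (0 : EuclideanSpace ℝ (Fin n)) 1, max (inner ℝ x u) 0 = c * ‖x‖ := by
  let e : EuclideanSpace ℝ (Fin n) := EuclideanSpace.single ⟨0, hn⟩ 1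
  have he : ‖e‖ = 1 := by simp [e]
  set B := Metric.closedBall (0 : EuclideanSpace ℝ (Fin n)) 1 with hB
  have hcB : IsCompact B := isCompact_closedBall _ _
  refine ⟨∫ u in B, max (inner ℝ e u) 0, ?_, fun x => ?_⟩
  · have hcont : Continuous fun u : EuclideanSpace ℝ (Fin n) => max (inner ℝ e u) 0 := by fun_prop
    rw [setIntegral_pos_iff_support_of_nonneg_ae (f := fun u => max (inner ℝ e u) 0)
      (Filter.Eventually.of_forall fun u => le_max_right _ _)
      (hcont.continuousOn.integrableOn_compact hcB)]
    have hop : IsOpen ({u : EuclideanSpace ℝ (Fin n) | 0 < inner ℝ e u} ∩ Metric.ball 0 1) :=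
      (isOpen_lt continuous_const (by fun_prop)).inter Metric.isOpen_ball
    have hne : ({u : EuclideanSpace ℝ (Fin n) | 0 < inner ℝ e u} ∩ Metric.ball 0 1).Nonempty := by
      refine ⟨(1 / 2 : ℝ) • e, ?_, ?_⟩
      · change 0 < inner ℝ e ((1 / 2 : ℝ) • e)
        rw [inner_smul_right, real_inner_self_eq_norm_sq, he]; norm_num
      · rw [mem_ball_zero_iff, norm_smul, he]; norm_num
    refine (hop.measure_pos volume hne).trans_le (measure_mono ?_)
    rintro u ⟨h1, h2⟩
    refine ⟨?_, Metric.ball_subset_closedBall h2⟩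
    have h1' : 0 < inner ℝ e u := h1
    simp only [Function.mem_support]
    rw [max_eq_left h1'.le]
    exact h1'.ne'
  · have hnorm : ‖‖x‖ • e‖ = ‖x‖ := by rw [norm_smul, he]; simp
    set R := (Submodule.span ℝ {‖x‖ • e - x})ᗮ.reflection
    have hR : R (‖x‖ • e) = x := Submodule.reflection_sub hnorm
    have hpre : R ⁻¹' B = B := by
      ext u; simp [hB]
    have h1 := R.measurePreserving.setIntegral_preimage_emb
      R.toHomeomorph.measurableEmbedding (fun u => max (inner ℝ x u) 0) B
    rw [← h1, hpre]
    have h2 : ∀ u, max (inner ℝ x (R u)) 0 = max (inner ℝ e u) 0 * ‖x‖ := by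
      intro u
      conv_lhs => rw [← hR, LinearIsometryEquiv.inner_map_map, inner_smul_left]
      rw [max_mul_of_nonneg _ _ (norm_nonneg x)]
      simp [mul_comm]
    simp_rw [h2]
    rw [integral_mul_const]

lemma exists_zon {n : ℕ} (hn : 0 < n) {δ : ℝ} (hδ : 0 < δ) :
    ∃ ws : List (EuclideanSpace ℝ (Fin n)), ∀ x, |zsup ws x - ‖x‖| ≤ δ * ‖x‖ := by
  obtain ⟨c, hc, hI⟩ := integral_ball_max hn
  set B := Metric.closedBall (0 : EuclideanSpace ℝ (Fin n)) 1 with hB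
  have hcB : IsCompact B := isCompact_closedBall _ _
  have hid : Integrable (fun u : EuclideanSpace ℝ (Fin n) => u) (volume.restrict B) :=
    continuous_id.continuousOn.integrableOn_compact hcB
  have hε : ENNReal.ofReal (c * δ) ≠ 0 := by
    rw [ne_eq, ENNReal.ofReal_eq_zero, not_le]; positivity
  obtain ⟨φ, hφ, hφm⟩ := (memLp_one_iff_integrable.2 hid).exists_simpleFunc_eLpNorm_sub_lt
    ENNReal.one_ne_top hε
  have hφi : Integrable φ (volume.restrict B) := memLp_one_iff_integrable.1 hφm
  have hL1 : ∫ u in B, ‖u - φ u‖ ≤ c * δ := by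
    rw [integral_norm_eq_lintegral_enorm (f := fun u => u - φ u) (hid.sub hφi).aestronglyMeasurable]
    rw [eLpNorm_one_eq_lintegral_enorm] at hφ
    exact ENNReal.toReal_le_of_le_ofReal (by positivity) hφ.le
  refine ⟨φ.range.toList.map
    (fun y => (((volume.restrict B).real (φ ⁻¹' {y})) / c) • y), fun x => ?_⟩
  have hsum : zsup (φ.range.toList.map
      (fun y => (((volume.restrict B).real (φ ⁻¹' {y})) / c) • y)) x =
      (∫ u in B, max (inner ℝ x (φ u)) 0) / c := by
    have h1 := SimpleFunc.map_integral φ (fun y => max (inner ℝ x y) 0) hφi (by simp)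
    have hgi : Integrable (φ.map (fun y => max (inner ℝ x y) 0)) (volume.restrict B) := by
      have := (hφi.const_inner (𝕜 := ℝ) x).pos_part
      exact this
    rw [SimpleFunc.integral_eq_integral _ hgi] at h1
    have h2 : ∫ u in B, max (inner ℝ x (φ u)) 0 =
      ∑ y ∈ φ.range, (volume.restrict B).real (φ ⁻¹' {y}) • max (inner ℝ x y) 0 := by
      rw [← h1]; rfl
    rw [h2, Finset.sum_div, zsup, List.map_map, Finset.sum_map_toList]
    refine Finset.sum_congr rfl fun y _ => ?_
    simp only [Function.comp, inner_smul_right, smul_eq_mul]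
    have : 0 ≤ (volume.restrict B).real (φ ⁻¹' {y}) / c := by positivity
    rw [mul_div_right_comm, mul_max_of_nonneg _ _ this, mul_zero]
  rw [hsum]
  have hi1 : Integrable (fun u => max (inner ℝ x u) 0) (volume.restrict B) :=
    (hid.const_inner (𝕜 := ℝ) x).pos_part
  have hi2 : Integrable (fun u => max (inner ℝ x (φ u)) 0) (volume.restrict B) :=
    (hφi.const_inner (𝕜 := ℝ) x).pos_part
  have hx : ‖x‖ = (∫ u in B, max (inner ℝ x u) 0) / c := by
    rw [hI]; field_simp
  have key : |(∫ u in B, max (inner ℝ x (φ u)) 0) - ∫ u in B, max (inner ℝ x u) 0| ≤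
      ‖x‖ * (c * δ) := by
    rw [← integral_sub hi2 hi1]
    calc |∫ u in B, (max (inner ℝ x (φ u)) 0 - max (inner ℝ x u) 0)|
        ≤ ∫ u in B, |max (inner ℝ x (φ u)) 0 - max (inner ℝ x u) 0| :=
          abs_integral_le_integral_abs
      _ ≤ ∫ u in B, ‖x‖ * ‖u - φ u‖ := by
          refine integral_mono (hi2.sub hi1).abs ((hid.sub hφi).norm.const_mul _) fun u => ?_
          refine (abs_max_sub_max_le_abs _ _ _).trans ?_
          rw [← inner_sub_right, norm_sub_rev]
          exact abs_real_inner_le_norm _ _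
      _ = ‖x‖ * ∫ u in B, ‖u - φ u‖ := integral_const_mul _ _
      _ ≤ _ := by gcongr
  calc |(∫ u in B, max (inner ℝ x (φ u)) 0) / c - ‖x‖|
      = |(∫ u in B, max (inner ℝ x (φ u)) 0) - ∫ u in B, max (inner ℝ x u) 0| / c := by
        conv_lhs => rw [hx, ← sub_div, abs_div, abs_of_pos hc]
    _ ≤ ‖x‖ * (c * δ) / c := by gcongr
    _ = δ * ‖x‖ := by field_simp

lemma coeff_lin (n m : ℕ) : ∃ l : ℕ → ℝ, ∀ p : Polynomial ℝ, p.natDegree ≤ n →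
    p.coeff m = ∑ j ∈ Finset.range (n + 1), p.eval (j : ℝ) * l j := by
  refine ⟨fun j => (Lagrange.basis (Finset.range (n + 1)) (fun j : ℕ => (j : ℝ)) j).coeff m,
    fun p hp => ?_⟩
  have h := Lagrange.eq_interpolate (s := Finset.range (n + 1)) (v := fun j : ℕ => (j : ℝ)) (f := p)
    (fun a _ b _ hab => Nat.cast_injective hab)
    (by
      rw [Finset.card_range]
      exact lt_of_le_of_lt Polynomial.degree_le_natDegree (by exact_mod_cast Nat.lt_succ_of_le hp))
  conv_lhs => rw [h, Lagrange.interpolate_apply]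
  simp [Polynomial.finsetSum_coeff, Polynomial.coeff_C_mul]

lemma poly_limit {n m : ℕ} {P : Polynomial ℝ} (hP : P.natDegree ≤ n) {a : ℕ → Polynomial ℝ}
    (ha : ∀ k, (a k).natDegree ≤ n)
    (h1 : ∀ k : ℕ, ∀ t : ℝ, 0 ≤ t → P.eval (t * (1 - 1 / ((k : ℝ) + 1))) ≤ (a k).eval t)
    (h2 : ∀ k : ℕ, ∀ t : ℝ, 0 ≤ t → (a k).eval t ≤ P.eval (t * (1 + 1 / ((k : ℝ) + 1)))) :
    Filter.Tendsto (fun k => (a k).coeff m) Filter.atTop (nhds (P.coeff m)) := by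
  obtain ⟨l, hl⟩ := coeff_lin n m
  simp_rw [fun k => hl (a k) (ha k)]
  rw [hl P hP]
  refine tendsto_finsetSum _ fun j _ => Filter.Tendsto.mul_const _ ?_
  have hlim := tendsto_one_div_add_atTop_nhds_zero_nat (𝕜 := ℝ)
  have t1 : Filter.Tendsto (fun k : ℕ => P.eval ((j : ℝ) * (1 - 1 / ((k : ℝ) + 1)))) Filter.atTop
      (nhds (P.eval (j : ℝ))) := by
    have : Filter.Tendsto (fun k : ℕ => (j : ℝ) * (1 - 1 / ((k : ℝ) + 1))) Filter.atTop
      (nhds ((j : ℝ) * (1 - 0))) := (hlim.const_sub 1).const_mul _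
    have := (P.continuous.tendsto _).comp this
    simpa [Function.comp_def] using this
  have t2 : Filter.Tendsto (fun k : ℕ => P.eval ((j : ℝ) * (1 + 1 / ((k : ℝ) + 1)))) Filter.atTop
      (nhds (P.eval (j : ℝ))) := by
    have : Filter.Tendsto (fun k : ℕ => (j : ℝ) * (1 + 1 / ((k : ℝ) + 1))) Filter.atTop
      (nhds ((j : ℝ) * (1 + 0))) := (hlim.const_add 1).const_mul _
    have := (P.continuous.tendsto _).comp this
    simpa [Function.comp_def] using this
  exact tendsto_of_tendsto_of_tendsto_of_le_of_le t1 t2 (fun k => h1 k j (by positivity))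
    (fun k => h2 k j (by positivity))

lemma steiner_compare {n i : ℕ} (hn : 0 < n) (hin : i ≤ n)
    (V : ℕ → Set (EuclideanSpace ℝ (Fin n)) → ℝ)
    (hV : ∀ L : Set (EuclideanSpace ℝ (Fin n)), Convex ℝ L → IsCompact L → L.Nonempty →
      ∀ t : ℝ, 0 ≤ t →
        (volume (L + Metric.closedBall (0 : EuclideanSpace ℝ (Fin n)) t)).toReal =
          ∑ j ∈ Finset.range (n + 1), kappa (n - j) * V j L * t ^ (n - j))
    {L1 L2 : Set (EuclideanSpace ℝ (Fin n))} (c1 : IsCompact L1) (v1 : Convex ℝ L1)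
    (n1 : L1.Nonempty) (c2 : IsCompact L2) (v2 : Convex ℝ L2) (n2 : L2.Nonempty) {θ : ℝ}
    (h : ∀ S : EuclideanSpace ℝ (Fin n) →ₗ[ℝ] (Fin i → ℝ),
      θ * (volume (S '' L1)).toReal ≤ (volume (S '' L2)).toReal) :
    θ * V i L1 ≤ V i L2 := by
  let P : Set (EuclideanSpace ℝ (Fin n)) → Polynomial ℝ := fun L =>
    ∑ j ∈ Finset.range (n + 1), Polynomial.C (kappa (n - j) * V j L) * Polynomial.X ^ (n - j)
  have Peval : ∀ L t, (P L).eval t =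
      ∑ j ∈ Finset.range (n + 1), kappa (n - j) * V j L * t ^ (n - j) := by
    intro L t; simp [P, Polynomial.eval_finsetSum]
  have Pdeg : ∀ L, (P L).natDegree ≤ n := by
    intro L
    refine Polynomial.natDegree_sum_le_of_forall_le _ _ fun j _ => ?_
    exact (Polynomial.natDegree_C_mul_X_pow_le _ _).trans (Nat.sub_le _ _)
  have Pcoeff : ∀ L, (P L).coeff (n - i) = kappa (n - i) * V i L := by
    intro L
    simp only [P, Polynomial.finsetSum_coeff, Polynomial.coeff_C_mul, Polynomial.coeff_X_pow]
    rw [Finset.sum_eq_single i]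
    · simp
    · intro j hj hji
      have : j < n + 1 := Finset.mem_range.1 hj
      rw [if_neg (by omega)]; simp
    · intro hni; exact absurd (Finset.mem_range.2 (by omega)) hni
  let T : EuclideanSpace ℝ (Fin n) →ₗ[ℝ] (Fin n → ℝ) :=
    (WithLp.linearEquiv 2 ℝ (Fin n → ℝ)).toLinearMap
  have hT : ∀ M : Set (EuclideanSpace ℝ (Fin n)), IsCompact M → volume (T '' M) = volume M := by
    intro M hM
    rw [← (PiLp.volume_preserving_toLp (Fin n)).measure_preimage hM.measurableSet.nullMeasurableSet]
    congr 1
    exact (WithLp.linearEquiv 2 ℝ (Fin n → ℝ)).toEquiv.image_eq_preimage_symm M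
  have hex : ∀ k : ℕ, ∃ ws : List (EuclideanSpace ℝ (Fin n)),
      Metric.closedBall 0 (1 - 1 / ((k : ℝ) + 1)) ⊆ zon ws ∧
      zon ws ⊆ Metric.closedBall 0 (1 + 1 / ((k : ℝ) + 1)) := by
    intro k
    have hk : 0 < 1 / ((k : ℝ) + 1) := by positivity
    obtain ⟨ws, hws⟩ := exists_zon hn hk
    exact ⟨ws, zon_between hk.le hws⟩
  choose ws hlo hup using hex
  choose a b ha hb hda hdb hab using fun k => zon_poly c1 v1 c2 v2 h (ws k) n T
  have bounds : ∀ L : Set (EuclideanSpace ℝ (Fin n)), IsCompact L → Convex ℝ L → L.Nonempty →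
      ∀ p : ℕ → Polynomial ℝ,
      (∀ k : ℕ, ∀ s : ℝ, 0 ≤ s → (volume (T '' (L + s • zon (ws k)))).toReal = (p k).eval s) →
      (∀ k : ℕ, ∀ t : ℝ, 0 ≤ t → (P L).eval (t * (1 - 1 / ((k : ℝ) + 1))) ≤ (p k).eval t) ∧
      (∀ k : ℕ, ∀ t : ℝ, 0 ≤ t → (p k).eval t ≤ (P L).eval (t * (1 + 1 / ((k : ℝ) + 1)))) := by
    intro L cL vL nL p hp
    have hscale : ∀ t r : ℝ, 0 ≤ t → 0 ≤ r →
        t • Metric.closedBall (0 : EuclideanSpace ℝ (Fin n)) r = Metric.closedBall 0 (t * r) := by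
      intro t r ht hr
      rw [smul_closedBall _ _ hr, smul_zero, Real.norm_of_nonneg ht]
    have hcz : ∀ k (t : ℝ), IsCompact (L + t • zon (ws k)) := fun k t =>
      cL.add ((zon_compact _).smul t)
    constructor
    · intro k t ht
      have hr : 0 ≤ 1 - 1 / ((k : ℝ) + 1) := by
        rw [sub_nonneg, div_le_one (by positivity)]; linarith [(Nat.cast_nonneg k : (0 : ℝ) ≤ k)]
      rw [Peval, ← hV L vL cL nL _ (mul_nonneg ht hr), ← hp k t ht, hT _ (hcz k t),
        ← hscale _ _ ht hr]
      exact ENNReal.toReal_mono (hcz k t).measure_lt_top.ne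
        (measure_mono (Set.add_subset_add_left (Set.smul_set_mono (hlo k))))
    · intro k t ht
      have hr : 0 ≤ 1 + 1 / ((k : ℝ) + 1) := by positivity
      rw [Peval, ← hV L vL cL nL _ (mul_nonneg ht hr), ← hp k t ht, hT _ (hcz k t),
        ← hscale _ _ ht hr]
      refine ENNReal.toReal_mono ?_
        (measure_mono (Set.add_subset_add_left (Set.smul_set_mono (hup k))))
      exact (cL.add ((isCompact_closedBall _ _).smul t)).measure_lt_top.ne
  obtain ⟨l1, u1⟩ := bounds L1 c1 v1 n1 a ha
  obtain ⟨l2, u2⟩ := bounds L2 c2 v2 n2 b hb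
  have t1 := poly_limit (m := n - i) (Pdeg L1) hda l1 u1
  have t2 := poly_limit (m := n - i) (Pdeg L2) hdb l2 u2
  have hfin := le_of_tendsto_of_tendsto' (t1.const_mul θ) t2 fun k => hab k hin
  rw [Pcoeff, Pcoeff] at hfin
  have hk : 0 < kappa (n - i) :=
    ENNReal.toReal_pos (Metric.measure_closedBall_pos volume _ one_pos).ne'
      (isCompact_closedBall _ _).measure_lt_top.ne
  refine le_of_mul_le_mul_left ?_ hk
  linarith

theorem intrinsic_volume_section_ineq (n k i : ℕ) (hi : 1 ≤ i) (hik : i ≤ k) (hkn : k < n)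
    (V : ℕ → Set (EuclideanSpace ℝ (Fin n)) → ℝ)
    (hV : ∀ L : Set (EuclideanSpace ℝ (Fin n)), Convex ℝ L → IsCompact L → L.Nonempty →
      ∀ t : ℝ, 0 ≤ t →
        (volume (L + Metric.closedBall (0 : EuclideanSpace ℝ (Fin n)) t)).toReal =
          ∑ j ∈ Finset.range (n + 1), kappa (n - j) * V j L * t ^ (n - j))
    (K : Set (EuclideanSpace ℝ (Fin n)))
    (hKconv : Convex ℝ K) (hKcomp : IsCompact K) (hKint : (interior K).Nonempty)
    (hcentroid : (∫ x in K, x) = 0)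
    (E : Submodule ℝ (EuclideanSpace ℝ (Fin n))) (hE : Module.finrank ℝ E = k) :
    ∀ x ∈ K,
      (((i : ℝ) + 1) / ((n : ℝ) + 1)) ^ i * V i ((fun y => y - x) '' K ∩ (E : Set _)) ≤
        V i (K ∩ (E : Set _)) := by
  intro x hx
  have hEc : IsClosed (E : Set (EuclideanSpace ℝ (Fin n))) := E.closed_of_finiteDimensional
  have hKx : IsCompact ((fun y => y - x) '' K) := hKcomp.image (by fun_prop)
  have hKxc : Convex ℝ ((fun y => y - x) '' K) := by
    have := hKconv.translate (-x)
    have e : (fun y => y - x) = fun y => -x + y := by funext y; abel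
    rw [e]; exact this
  have hvol0 : volume K ≠ 0 := by
    have := isOpen_interior.measure_pos volume hKint
    exact (this.trans_le (measure_mono interior_subset)).ne'
  have h0 : (0 : EuclideanSpace ℝ (Fin n)) ∈ K := by
    have := hKconv.set_average_mem (μ := volume) (t := K) (f := fun x => x) hKcomp.isClosed hvol0
      hKcomp.measure_lt_top.ne
      (by filter_upwards [ae_restrict_mem hKcomp.measurableSet] with y hy using hy)
      (continuous_id.continuousOn.integrableOn_compact hKcomp)
    rw [setAverage_eq, hcentroid, smul_zero] at this
    exact this
  refine steiner_compare (by omega) (by omega) V hV (hKx.inter_right hEc) (hKxc.inter E.convex)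
    ⟨0, ⟨x, hx, by simp⟩, E.zero_mem⟩ (hKcomp.inter_right hEc) (hKconv.inter E.convex)
    ⟨0, h0, E.zero_mem⟩ fun S => ?_
  exact proj_ineq hi hik hkn hKconv hKcomp hKint hcentroid E hE hx S
end
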